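/- arXiv:1303.5944 — 3 statements merged into one kernel-verified Lean document; each statement's English description precedes it below -/
import Mathlib

section
/- Fix real parameters M>0, l>0, a with |a|<l, and α<9/4, let E ∈ (1/l², V_max), and let δ>0 be such that [E−δ, E+δ] ⊂ (1/l², V_max). For h>0 let Spec(h) denote the set of κ ∈ ℝ that are eigenvalues of the Dirichlet problem P_DD(h). Then for all sufficiently small h>0 the set Spec(h) ∩ [E−δ, E+δ] is finite, and, denoting by N(h) its cardinality, one has 2π·h·N(h) → Q as h → 0⁺, where Q = 2·∫_{x_max}^{π/2} ( √(max(0, E+δ − V_σ(R(x)))) − √(max(0, E−δ − V_σ(R(x)))) ) dx (Weyl's law). -/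
open Real MeasureTheory Set Filter Topology

/-- Δ₋(r) = (1+r²/l²)(r²+a²) − 2Mr -/
noncomputable def Dm (M l a r : ℝ) : ℝ := (1 + r^2/l^2)*(r^2+a^2) - 2*M*r

/-- V_σ(r) = Δ₋(r)/(r²+a²)² -/
noncomputable def Vsig (M l a r : ℝ) : ℝ := Dm M l a r / (r^2+a^2)^2

/-- Θ(α) = 1 if α>0, 0 if α≤0 -/
noncomputable def Th (α : ℝ) : ℝ := if 0 < α then 1 else 0

/-- V_junk -/
noncomputable def Vjunk (M l a α r : ℝ) : ℝ :=
  -(3*r^2*(Dm M l a r)^2/(r^2+a^2)^4)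
  + Dm M l a r * (5*r^4/l^2 + 3*r^2*(1+a^2/l^2) - 4*M*r + a^2)/(r^2+a^2)^3
  - (2/l^2) * (Dm M l a r * r^2/(r^2+a^2)^2)
  - (α/l^2) * (Dm M l a r /(r^2+a^2)^2) * Th α * a^2

/-- V_mass -/
noncomputable def Vmass (M l a α r : ℝ) : ℝ :=
  ((2-α)/l^2) * (Dm M l a r * r^2/(r^2+a^2)^2)

/-- The full potential in the tortoise coordinate, with semiclassical parameter h. -/
noncomputable def Vfull (M l a α : ℝ) (R : ℝ → ℝ) (h x : ℝ) : ℝ :=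
  Vsig M l a (R x) + h^2 * (Vjunk M l a α (R x) + Vmass M l a α (R x))

/-- κ is an eigenvalue of the Dirichlet problem P_DD(h). -/
def IsDirichletEigenvalue (M l a α : ℝ) (R : ℝ → ℝ) (xmax h κ : ℝ) : Prop :=
  ∃ u : ℝ → ℝ,
    (∃ x ∈ Set.Ico xmax (π/2), u x ≠ 0) ∧
    ContDiffOn ℝ 2 u (Set.Ico xmax (π/2)) ∧
    (∀ x ∈ Set.Ioo xmax (π/2),
      -h^2 * deriv (deriv u) x + Vfull M l a α R h x * u x = κ * u x) ∧
    u xmax = 0 ∧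
    MeasureTheory.IntegrableOn (fun x => (deriv u x)^2 + (R x)^2 * (u x)^2)
      (Set.Ioo xmax (π/2))

/-- The inner Volterra kernel operator. -/
noncomputable def vIn (s : ℝ) (C g : ℝ × ℝ → ℝ) (t lam : ℝ) : ℝ :=
  ∫ σ in (0:ℝ)..1, σ ^ (2*s-1) * C (t*σ, lam) * g (t*σ, lam)

lemma vIn_cont (s : ℝ) (hs : 1/2 < s) (C g : ℝ × ℝ → ℝ) (hC : Continuous C) (hg : Continuous g) :
    Continuous (fun p : ℝ × ℝ => vIn s C g p.1 p.2) := by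
  unfold vIn
  apply intervalIntegral.continuous_parametric_intervalIntegral_of_continuous'
  have : Continuous (fun x : ℝ => x ^ (2*s-1)) :=
    Real.continuous_rpow_const (by linarith)
  simp only [Function.uncurry_def]
  fun_prop

lemma vIn_sub (s : ℝ) (hs : 1/2 < s) (C g₁ g₂ : ℝ × ℝ → ℝ) (hC : Continuous C)
    (hg₁ : Continuous g₁) (hg₂ : Continuous g₂) (t lam : ℝ) :
    vIn s C g₁ t lam - vIn s C g₂ t lam = vIn s C (fun p => g₁ p - g₂ p) t lam := by
  unfold vIn
  have : Continuous (fun x : ℝ => x ^ (2*s-1)) :=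
    Real.continuous_rpow_const (by linarith)
  rw [← intervalIntegral.integral_sub]
  · congr 1; ext σ; ring
  · apply Continuous.intervalIntegrable; fun_prop
  · apply Continuous.intervalIntegrable; fun_prop

lemma vIn_bound (s : ℝ) (hs : 1/2 < s) (C g : ℝ × ℝ → ℝ) (t lam : ℝ) (D : ℝ)
    (hD : ∀ σ ∈ Icc (0:ℝ) 1, |C (t*σ, lam)| * |g (t*σ, lam)| ≤ D) :
    |vIn s C g t lam| ≤ D := by
  unfold vIn
  have h := intervalIntegral.norm_integral_le_of_norm_le_const (a := (0:ℝ)) (b := 1) (C := D)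
    (f := fun σ : ℝ => σ ^ (2*s-1) * C (t*σ, lam) * g (t*σ, lam)) ?_
  · simpa using h
  · intro σ hσ
    rw [uIoc_of_le zero_le_one] at hσ
    have h1 := hD σ ⟨hσ.1.le, hσ.2⟩
    have h2 : σ ^ (2*s-1) ≤ 1 := Real.rpow_le_one hσ.1.le hσ.2 (by linarith)
    have h3 : 0 ≤ σ ^ (2*s-1) := Real.rpow_nonneg hσ.1.le _
    rw [Real.norm_eq_abs, abs_mul, abs_mul, abs_of_nonneg h3, mul_assoc]
    have : 0 ≤ |C (t*σ, lam)| * |g (t*σ, lam)| := by positivity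
    nlinarith

lemma int_exp_le (K Y : ℝ) (hK : 0 < K) : ∫ t in (0:ℝ)..Y, exp (K*t) ≤ exp (K*Y) / K := by
  have : ∫ t in (0:ℝ)..Y, exp (K*t) = exp (K*Y)/K - exp (K*0)/K := by
    apply intervalIntegral.integral_eq_sub_of_hasDerivAt
    · intro x _
      have := ((hasDerivAt_id x).const_mul K).exp.div_const K
      simp only [id] at this
      exact this.congr_deriv (by rw [mul_one, mul_div_assoc, div_self hK.ne', mul_one])
    · apply Continuous.intervalIntegrable; fun_prop
  rw [this]
  have : 0 < exp (K*0)/K := by positivity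
  linarith

lemma volterra (s : ℝ) (hs : 1/2 < s) (C : ℝ × ℝ → ℝ) (hC : Continuous C) (A : ℝ)
    (hA : ∀ p, |C p| ≤ A) :
    ∃ g : ℝ × ℝ → ℝ, Continuous g ∧ ∀ y, 0 ≤ y → ∀ lam,
      g (y, lam) = 1 + ∫ t in (0:ℝ)..y, vIn s C g t lam := by
  have hA0 : 0 ≤ A := (abs_nonneg _).trans (hA (0,0))
  set K : ℝ := 2*A+1 with hK
  have hKpos : 0 < K := by positivity
  set wt : ℝ × ℝ → ℝ := fun p => exp (K * max p.1 0) with hwt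
  have hwtc : Continuous wt := by simp only [hwt]; fun_prop
  -- the integral operator
  set J : (ℝ × ℝ → ℝ) → ℝ × ℝ → ℝ := fun g p =>
    ∫ t in (0:ℝ)..(max p.1 0), vIn s C (fun q => wt q * g q) t p.2 with hJ
  have hJc : ∀ g, Continuous g → Continuous (J g) := by
    intro g hg
    apply intervalIntegral.continuous_parametric_intervalIntegral_of_continuous
    · have := vIn_cont s hs C (fun q => wt q * g q) hC (by fun_prop)
      simp only [Function.uncurry_def]
      exact this.comp (f := fun x : (ℝ×ℝ)×ℝ => (x.2, x.1.2)) (by fun_prop)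
    · fun_prop
  have hJb : ∀ g N, Continuous g → (∀ p, |g p| ≤ N) → ∀ p, |J g p| ≤ (1/2 * N) * wt p := by
    intro g N hg hN p
    have hN0 : 0 ≤ N := (abs_nonneg _).trans (hN p)
    have hY : 0 ≤ max p.1 0 := le_max_right _ _
    have h1 : ‖J g p‖ ≤ ∫ t in (0:ℝ)..(max p.1 0), A * N * exp (K*t) := by
      apply intervalIntegral.norm_integral_le_of_norm_le hY
      · filter_upwards with t ht
        rw [Real.norm_eq_abs]
        apply vIn_bound s hs
        intro σ hσ
        have e1 : |wt (t*σ, p.2) * g (t*σ, p.2)| ≤ exp (K*t) * N := by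
          rw [abs_mul]
          apply mul_le_mul _ (hN _) (abs_nonneg _) (exp_pos _).le
          rw [abs_of_pos (exp_pos _)]
          apply exp_le_exp.mpr
          apply mul_le_mul_of_nonneg_left _ hKpos.le
          simp only
          apply max_le _ ht.1.le
          nlinarith [hσ.1, hσ.2, ht.1]
        calc _ ≤ A * (exp (K*t) * N) := mul_le_mul (hA _) e1 (abs_nonneg _) hA0
          _ = _ := by ring
      · apply Continuous.intervalIntegrable; fun_prop
    rw [intervalIntegral.integral_const_mul] at h1
    have h2 := int_exp_le K (max p.1 0) hKpos
    calc |J g p| ≤ A * N * (exp (K * max p.1 0) / K) :=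
          h1.trans (mul_le_mul_of_nonneg_left h2 (by positivity))
      _ = (A / K * N) * wt p := by simp only [hwt]; field_simp
      _ ≤ (1/2 * N) * wt p := by
          apply mul_le_mul_of_nonneg_right _ (exp_pos _).le
          apply mul_le_mul_of_nonneg_right _ hN0
          rw [div_le_iff₀ hKpos]; rw [hK]; linarith
  have hwt1 : ∀ p, 1 ≤ wt p := fun p => by
    simp only [hwt]; apply one_le_exp; have : 0 ≤ max p.1 0 := le_max_right _ _
    positivity
  have hJs : ∀ g₁ g₂, Continuous g₁ → Continuous g₂ → ∀ p,
      J g₁ p - J g₂ p = J (fun q => g₁ q - g₂ q) p := by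
    intro g₁ g₂ h1 h2 p
    simp only [hJ]
    have c : ∀ g, Continuous g → Continuous (fun t => vIn s C (fun q => wt q * g q) t p.2) := by
      intro g hg
      have := vIn_cont s hs C (fun q => wt q * g q) hC (by fun_prop)
      exact this.comp (f := fun x : ℝ => (x, p.2)) (by fun_prop)
    rw [← intervalIntegral.integral_sub ((c g₁ h1).intervalIntegrable _ _)
      ((c g₂ h2).intervalIntegrable _ _)]
    congr 1; ext t
    rw [vIn_sub s hs C _ _ hC (by fun_prop) (by fun_prop)]
    congr 1; ext q; ring
  let Φ : BoundedContinuousFunction (ℝ × ℝ) ℝ → BoundedContinuousFunction (ℝ × ℝ) ℝ := fun g =>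
    BoundedContinuousFunction.ofNormedAddCommGroup (fun p => (wt p)⁻¹ * (1 + J g p))
      (by
        have := hJc g g.continuous
        apply Continuous.mul _ (by fun_prop)
        apply hwtc.inv₀; intro p; exact (lt_of_lt_of_le one_pos (hwt1 p)).ne')
      (1 + 1/2 * ‖g‖)
      (by
        intro p
        have h0 := hwt1 p
        have h1 := hJb g ‖g‖ g.continuous (fun p => g.norm_coe_le_norm p) p
        rw [norm_mul, norm_inv, Real.norm_eq_abs, abs_of_pos (by linarith), Real.norm_eq_abs,
          inv_mul_le_iff₀ (by linarith)]
        calc _ ≤ 1 + |J g p| := by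
              have := abs_add_le 1 (J g p); simpa using this
          _ ≤ _ := by nlinarith [norm_nonneg g])
  have hΦ : ContractingWith (1/2) Φ := by
    refine ⟨by rw [← NNReal.coe_lt_coe]; norm_num, ?_⟩
    apply LipschitzWith.of_dist_le_mul
    intro g₁ g₂
    rw [BoundedContinuousFunction.dist_le (by positivity)]
    intro p
    have h0 := hwt1 p
    have e : Φ g₁ p - Φ g₂ p = (wt p)⁻¹ * J (fun q => g₁ q - g₂ q) p := by
      rw [← hJs _ _ g₁.continuous g₂.continuous]
      simp only [Φ, BoundedContinuousFunction.coe_ofNormedAddCommGroup]; ring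
    have h1 := hJb (fun q => g₁ q - g₂ q) (dist g₁ g₂) (by fun_prop) (fun p => by
      have := BoundedContinuousFunction.dist_coe_le_dist (f := g₁) (g := g₂) p
      rwa [Real.dist_eq] at this) p
    rw [Real.dist_eq, e, abs_mul, abs_inv, abs_of_pos (by linarith : 0 < wt p),
      inv_mul_le_iff₀ (by linarith)]
    calc _ ≤ _ := h1
      _ = _ := by push_cast; ring
  have hfix := hΦ.fixedPoint_isFixedPt
  set f := ContractingWith.fixedPoint Φ hΦ
  refine ⟨fun q => wt q * f q, by fun_prop, ?_⟩
  intro y hy lam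
  have h1 : f (y, lam) = (wt (y,lam))⁻¹ * (1 + J f (y,lam)) := by
    conv_lhs => rw [← hfix.eq]
    rfl
  have h0 := hwt1 (y,lam)
  simp only [h1]
  rw [mul_inv_cancel_left₀ (by linarith)]
  simp only [hJ, max_eq_left hy]

lemma vIn_hasDerivAt (s : ℝ) (hs : 1/2 < s) (C g : ℝ × ℝ → ℝ) (hC : Continuous C)
    (hg : Continuous g) (lam y : ℝ) (hy : 0 < y) :
    HasDerivAt (fun t => vIn s C g t lam)
      (-(2*s)/y * vIn s C g y lam + C (y,lam) / y * g (y,lam)) y := by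
  have hr : Continuous (fun x : ℝ => x ^ (2*s-1)) :=
    Real.continuous_rpow_const (by linarith)
  set f : ℝ → ℝ := fun τ => τ ^ (2*s-1) * C (τ, lam) * g (τ, lam) with hf
  have hfc : Continuous f := by simp only [hf]; fun_prop
  have key : ∀ t, 0 < t → vIn s C g t lam = t ^ (-(2*s)) * ∫ τ in (0:ℝ)..t, f τ := by
    intro t ht
    have e1 : ∫ σ in (0:ℝ)..1, f (t*σ) = t⁻¹ * ∫ τ in (0:ℝ)..t, f τ := by
      have := intervalIntegral.integral_comp_mul_left (a := (0:ℝ)) (b := 1) f ht.ne'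
      simpa using this
    have e2 : ∫ σ in (0:ℝ)..1, f (t*σ) = t ^ (2*s-1) * vIn s C g t lam := by
      unfold vIn
      rw [← intervalIntegral.integral_const_mul]
      apply intervalIntegral.integral_congr
      intro σ hσ
      rw [uIcc_of_le zero_le_one] at hσ
      simp only [hf]
      rw [Real.mul_rpow ht.le hσ.1]; ring
    rw [e2] at e1
    have h3 : t ^ (-(2*s)) = (t ^ (2*s-1))⁻¹ * t⁻¹ := by
      rw [← Real.rpow_neg ht.le, ← Real.rpow_neg_one t, ← Real.rpow_add ht]; congr 1; ring
    have h4 : t ^ (2*s-1) ≠ 0 := (Real.rpow_pos_of_pos ht _).ne'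
    rw [h3, mul_assoc, ← e1]; field_simp
  have h1 : HasDerivAt (fun t => t ^ (-(2*s)) * ∫ τ in (0:ℝ)..t, f τ)
      ((-(2*s)) * y ^ (-(2*s) - 1) * (∫ τ in (0:ℝ)..y, f τ) + y ^ (-(2*s)) * f y) y :=
    (Real.hasDerivAt_rpow_const (Or.inl hy.ne')).mul (hfc.integral_hasStrictDerivAt 0 y).hasDerivAt
  have h2 : (fun t => vIn s C g t lam) =ᶠ[𝓝 y] (fun t => t ^ (-(2*s)) * ∫ τ in (0:ℝ)..t, f τ) := by
    filter_upwards [lt_mem_nhds hy] with t ht using key t ht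
  refine (h1.congr_of_eventuallyEq h2).congr_deriv ?_
  rw [key y hy, Real.rpow_sub_one hy.ne']
  have h5 : y ^ (-(2*s)) * f y = C (y,lam) / y * g (y,lam) := by
    simp only [hf]
    have : y ^ (-(2*s)) * y ^ (2*s-1) = y⁻¹ := by
      rw [← Real.rpow_add hy, ← Real.rpow_neg_one]; congr 1; ring
    calc _ = (y ^ (-(2*s)) * y ^ (2*s-1)) * C (y,lam) * g (y,lam) := by ring
      _ = _ := by rw [this]; field_simp
  rw [h5]; field_simp

lemma recessive (s L lam1 lam2 A : ℝ) (hs : 1/2 < s) (hL : 0 < L) (hlam : lam1 ≤ lam2)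
    (B : ℝ → ℝ) (hB : ContinuousOn B (Ioc 0 L)) (hBA : ∀ y ∈ Ioc 0 L, |B y| ≤ A) :
    ∃ ψ dψ p : ℝ × ℝ → ℝ,
      ContinuousOn ψ (Ioi 0 ×ˢ univ) ∧ ContinuousOn dψ (Ioi 0 ×ˢ univ) ∧
      ContinuousOn p (Ioi 0 ×ˢ univ) ∧
      (∀ y > 0, ∀ lam, HasDerivAt (fun y => ψ (y,lam)) (dψ (y,lam)) y) ∧
      (∀ y > 0, ∀ lam, HasDerivAt (fun y => dψ (y,lam)) (p (y,lam) * ψ (y,lam)) y) ∧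
      (∀ y ∈ Ioc 0 L, ∀ lam ∈ Icc lam1 lam2, p (y,lam) = s*(s-1)/y^2 + B y - lam) ∧
      (∃ Cb > 0, ∀ y ∈ Ioc 0 L, ∀ lam ∈ Icc lam1 lam2,
        |ψ (y,lam)| ≤ Cb * y^s ∧ |dψ (y,lam)| ≤ Cb * y^(s-1)) ∧
      (∀ k > 0, (∀ y ∈ Ioc 0 L, ∀ lam ∈ Icc lam1 lam2, |B y - lam| ≤ k^2) →
        ∀ y, 0 < y → y ≤ L → y * k ≤ 1/2 → ∀ lam ∈ Icc lam1 lam2, 0 < ψ (y,lam)) := by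
  have hA0 : 0 ≤ A := (abs_nonneg _).trans (hBA L ⟨hL, le_rfl⟩)
  set c : ℝ → ℝ := fun t => max 0 (min t L) with hc
  have hcc : Continuous c := by simp only [hc]; fun_prop
  have hcI : ∀ t, c t ∈ Icc 0 L := fun t => ⟨le_max_left _ _, max_le hL.le (min_le_right _ _)⟩
  have hcid : ∀ t ∈ Icc 0 L, c t = t := fun t ht => by
    simp only [hc]; rw [min_eq_left ht.2, max_eq_right ht.1]
  set cl : ℝ → ℝ := fun t => max lam1 (min t lam2) with hcl
  have hclc : Continuous cl := by simp only [hcl]; fun_prop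
  have hclI : ∀ t, cl t ∈ Icc lam1 lam2 :=
    fun t => ⟨le_max_left _ _, max_le hlam (min_le_right _ _)⟩
  have hclid : ∀ t ∈ Icc lam1 lam2, cl t = t := fun t ht => by
    simp only [hcl]; rw [min_eq_left ht.2, max_eq_right ht.1]
  have hb1 : ContinuousOn (fun t => t * B t) (Icc 0 L) := by
    intro t ht
    rcases ht.1.eq_or_lt with h0 | h0
    · subst h0
      have : Tendsto (fun t => t * B t) (𝓝[Icc 0 L] 0) (𝓝 0) := by
        apply squeeze_zero_norm' (a := fun t => A * |t|)
        · filter_upwards [self_mem_nhdsWithin] with t ht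
          rcases ht.1.eq_or_lt with h0 | h0
          · subst h0; simp
          · rw [norm_mul, Real.norm_eq_abs, Real.norm_eq_abs, mul_comm]
            exact mul_le_mul_of_nonneg_right (hBA t ⟨h0, ht.2⟩) (abs_nonneg _)
        · have : Continuous (fun t : ℝ => A * |t|) := by fun_prop
          have := this.tendsto 0
          simp only [abs_zero, mul_zero] at this
          exact this.mono_left nhdsWithin_le_nhds
      simpa [ContinuousWithinAt] using this
    · have h1 : ContinuousWithinAt B (Icc 0 L) t := by
        apply (hB t ⟨h0, ht.2⟩).mono_of_mem_nhdsWithin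
        have : Ioi (0:ℝ) ∈ 𝓝[Icc 0 L] t := mem_nhdsWithin_of_mem_nhds (Ioi_mem_nhds h0)
        filter_upwards [this, self_mem_nhdsWithin] with u h1 h2 using ⟨h1, h2.2⟩
      exact continuousWithinAt_id.mul h1
  have hb1c : Continuous (fun t => c t * B (c t)) := by
    have := hb1.comp_continuous hcc hcI
    exact this
  set C : ℝ × ℝ → ℝ := fun q => c q.1 * B (c q.1) - c q.1 * cl q.2 with hC
  have hCc : Continuous C := by
    have : Continuous (fun q : ℝ × ℝ => c q.1 * B (c q.1)) := hb1c.comp continuous_fst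
    simp only [hC]; fun_prop
  have hCb : ∀ q, |C q| ≤ L * A + L * (|lam1| + |lam2|) := by
    intro q
    have h1 := hcI q.1
    have h2 := hclI q.2
    have h3 : |cl q.2| ≤ |lam1| + |lam2| := by
      rw [abs_le]; constructor
      · have := neg_abs_le lam1; have := abs_nonneg lam2; linarith [h2.1]
      · have := le_abs_self lam2; have := abs_nonneg lam1; linarith [h2.2]
    have h4 : |c q.1 * B (c q.1)| ≤ L * A := by
      rcases h1.1.eq_or_lt with h0 | h0
      · rw [← h0]; simp; positivity
      · rw [abs_mul, abs_of_nonneg h1.1]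
        exact mul_le_mul h1.2 (hBA _ ⟨h0, h1.2⟩) (abs_nonneg _) hL.le
    calc |C q| ≤ |c q.1 * B (c q.1)| + |c q.1 * cl q.2| := abs_sub _ _
      _ ≤ _ := by
        apply add_le_add h4
        rw [abs_mul, abs_of_nonneg h1.1]
        exact mul_le_mul h1.2 h3 (abs_nonneg _) hL.le
  obtain ⟨g, hg, hgeq⟩ := volterra s hs C hCc _ hCb
  have hGc := vIn_cont s hs C g hCc hg
  have hgd : ∀ y > 0, ∀ lam, HasDerivAt (fun y => g (y,lam)) (vIn s C g y lam) y := by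
    intro y hy lam
    have h1 : Continuous (fun t => vIn s C g t lam) :=
      hGc.comp (f := fun x : ℝ => (x, lam)) (by fun_prop)
    have h2 := (h1.integral_hasStrictDerivAt 0 y).hasDerivAt.const_add 1
    apply h2.congr_of_eventuallyEq
    filter_upwards [lt_mem_nhds hy] with t ht using hgeq t ht.le lam
  have hrp : ∀ r : ℝ, ContinuousOn (fun q : ℝ × ℝ => q.1 ^ r) (Ioi 0 ×ˢ univ) := by
    intro r
    apply ContinuousOn.rpow_const continuousOn_fst
    intro q hq; left; exact (ne_of_gt hq.1)
  have hGc' : Continuous (fun p : ℝ × ℝ => vIn s C g p.1 p.2) := hGc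
  refine ⟨fun q => q.1 ^ s * g q, fun q => s * q.1 ^ (s-1) * g q + q.1 ^ s * vIn s C g q.1 q.2,
    fun q => s*(s-1)/q.1^2 + C q / q.1, ?_, ?_, ?_, ?_, ?_, ?_, ?_, ?_⟩
  · exact (hrp s).mul hg.continuousOn
  · exact ((continuousOn_const.mul (hrp (s-1))).mul hg.continuousOn).add
      ((hrp s).mul hGc'.continuousOn)
  · apply ContinuousOn.add
    · apply ContinuousOn.div continuousOn_const (by fun_prop)
      intro q hq; exact pow_ne_zero 2 (ne_of_gt hq.1)
    · apply hCc.continuousOn.div continuousOn_fst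
      intro q hq; exact (ne_of_gt hq.1)
  · intro y hy lam
    have := (Real.hasDerivAt_rpow_const (p := s) (Or.inl hy.ne')).mul (hgd y hy lam)
    exact this
  · intro y hy lam
    have h1 := (((Real.hasDerivAt_rpow_const (p := s-1) (Or.inl hy.ne')).const_mul s).mul
      (hgd y hy lam)).add ((Real.hasDerivAt_rpow_const (p := s) (Or.inl hy.ne')).mul
      (vIn_hasDerivAt s hs C g hCc hg lam y hy))
    refine h1.congr_deriv ?_
    simp only
    have e1 : y ^ (s-1) = y ^ s / y := Real.rpow_sub_one hy.ne' s
    have e2 : y ^ (s-1-1) = y ^ s / y / y := by rw [Real.rpow_sub_one hy.ne', e1]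
    rw [e2, e1]; field_simp; ring
  · intro y hy lam hl
    simp only [hC, hcid y ⟨hy.1.le, hy.2⟩, hclid lam hl]
    have := hy.1.ne'
    field_simp
    ring
  · have hK : IsCompact (Icc (0:ℝ) L ×ˢ Icc lam1 lam2) := isCompact_Icc.prod isCompact_Icc
    obtain ⟨N1, hN1⟩ := hK.exists_bound_of_continuousOn hg.continuousOn
    obtain ⟨N2, hN2⟩ := hK.exists_bound_of_continuousOn hGc'.continuousOn
    set N := max 1 (max N1 N2)
    have hN : 1 ≤ N := le_max_left _ _
    refine ⟨(1 + s + L) * N, by positivity, ?_⟩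
    intro y hy lam hl
    have m : (y,lam) ∈ Icc (0:ℝ) L ×ˢ Icc lam1 lam2 := ⟨⟨hy.1.le, hy.2⟩, hl⟩
    have b1 : |g (y,lam)| ≤ N := (hN1 _ m).trans ((le_max_left _ _).trans (le_max_right _ _))
    have b2 : |vIn s C g y lam| ≤ N :=
      (hN2 _ m).trans ((le_max_right _ _).trans (le_max_right _ _))
    have p1 : 0 < y ^ s := Real.rpow_pos_of_pos hy.1 _
    have p2 : 0 < y ^ (s-1) := Real.rpow_pos_of_pos hy.1 _
    have e : y ^ s = y ^ (s-1) * y := by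
      rw [Real.rpow_sub_one hy.1.ne']; have := hy.1.ne'; field_simp
    constructor
    · simp only
      rw [abs_mul, abs_of_pos p1, mul_comm]
      apply mul_le_mul_of_nonneg_right _ p1.le
      nlinarith
    · simp only
      calc _ ≤ |s * y ^ (s-1) * g (y,lam)| + |y ^ s * vIn s C g y lam| := abs_add_le _ _
        _ = s * y ^ (s-1) * |g (y,lam)| + y ^ (s-1) * y * |vIn s C g y lam| := by
          rw [abs_mul, abs_mul, abs_mul, abs_of_pos p1, abs_of_pos p2,
            abs_of_pos (by linarith : 0 < s), e]
        _ ≤ s * y ^ (s-1) * N + y ^ (s-1) * L * N := by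
          have : 0 ≤ s := by linarith
          have := hy.1
          gcongr
          exact hy.2
        _ ≤ _ := by nlinarith
  · intro k hk hkb y hy hyL hyk lam hl
    simp only
    apply mul_pos (Real.rpow_pos_of_pos hy _)
    have hgl : Continuous (fun t => |g (t,lam)|) := by fun_prop
    obtain ⟨ym, hym, hmax⟩ := (isCompact_Icc (a := (0:ℝ)) (b := y)).exists_isMaxOn
      ⟨0, le_rfl, hy.le⟩ hgl.continuousOn
    set S := |g (ym,lam)| with hS
    have hS' : ∀ t ∈ Icc 0 y, |g (t,lam)| ≤ S := fun t ht => hmax ht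
    have hS0 : 0 ≤ S := abs_nonneg _
    have hest : ∀ z ∈ Icc 0 y, |g (z,lam) - 1| ≤ S/4 := by
      intro z hz
      rw [hgeq z hz.1 lam]
      simp only [add_sub_cancel_left]
      have := intervalIntegral.norm_integral_le_of_norm_le_const (a := (0:ℝ)) (b := z)
        (C := y * k^2 * S) (f := fun t => vIn s C g t lam) ?_
      · rw [Real.norm_eq_abs] at this
        refine this.trans ?_
        rw [sub_zero, abs_of_nonneg hz.1]
        have h1 : (y*k)*(y*k) ≤ 1/2*(1/2) := by
          apply mul_le_mul hyk hyk (by positivity) (by norm_num)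
        have h2 : y * k^2 * S * z ≤ y * k^2 * S * y := by
          apply mul_le_mul_of_nonneg_left hz.2; positivity
        nlinarith
      · intro t ht
        rw [uIoc_of_le hz.1] at ht
        rw [Real.norm_eq_abs]
        apply vIn_bound s hs
        intro σ hσ
        have hts0 : 0 ≤ t*σ := mul_nonneg ht.1.le hσ.1
        have hts1 : t*σ ≤ y := by nlinarith [ht.1, hσ.1, hσ.2, ht.2, hz.2]
        apply mul_le_mul _ (hS' _ ⟨hts0, hts1⟩) (abs_nonneg _) (by positivity)
        simp only [hC, hclid lam hl, hcid _ ⟨hts0, hts1.trans hyL⟩]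
        rcases hts0.eq_or_lt with h0 | h0
        · rw [← h0]; simp; positivity
        · rw [← mul_sub, abs_mul, abs_of_nonneg hts0]
          exact mul_le_mul hts1 (hkb _ ⟨h0, hts1.trans hyL⟩ _ hl) (abs_nonneg _) hy.le
    have h1 := hest ym hym
    have h2 := hest y ⟨hy.le, le_rfl⟩
    have h3 : S ≤ 1 + S/4 := by
      have := abs_sub_abs_le_abs_sub (g (ym,lam)) 1
      rw [abs_one] at this; linarith
    have := (abs_le.mp h2).1
    linarith

lemma pos_of_deriv_ge (D D' : ℝ → ℝ) (c d C : ℝ)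
    (hD : ∀ y ∈ Icc c d, HasDerivAt D (D' y) y)
    (hb : ∀ y ∈ Icc c d, -C * |D y| ≤ D' y) (h0 : 0 < D c) :
    ∀ y ∈ Icc c d, 0 < D y := by
  intro y hy
  have key := image_le_of_deriv_right_lt_deriv_boundary (f := fun y => - D y)
    (f' := fun y => - D' y) (a := c) (b := d)
    (B := fun y => -(D c * exp (-(C+1)*(y-c))))
    (B' := fun y => -(D c * (exp (-(C+1)*(y-c)) * (-(C+1)))))
    (fun x hx => (hD x hx).continuousAt.neg.continuousWithinAt)
    (fun x hx => (hD x (Ico_subset_Icc_self hx)).neg.hasDerivWithinAt)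
    (by simp)
    (fun x => by
      have h1 : HasDerivAt (fun y => -(C+1)*(y-c)) (-(C+1)) x := by
        simpa using ((hasDerivAt_id x).sub_const c).const_mul (-(C+1))
      exact (h1.exp.const_mul (D c)).neg)
    (fun x hx he => by
      have he' : D x = D c * exp (-(C+1)*(x-c)) := neg_injective he
      have hp : 0 < D c * exp (-(C+1)*(x-c)) := by positivity
      have := hb x (Ico_subset_Icc_self hx)
      rw [he', abs_of_pos hp] at this
      nlinarith)
    hy
  have hp : 0 < D c * exp (-(C+1)*(y-c)) := by positivity
  linarith

lemma nondegen (ψ dψ p : ℝ × ℝ → ℝ) (L y0 lam : ℝ) (hy0 : 0 < y0)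
    (hp : ContinuousOn p (Ioi 0 ×ˢ univ))
    (h1 : ∀ y > 0, HasDerivAt (fun y => ψ (y,lam)) (dψ (y,lam)) y)
    (h2 : ∀ y > 0, HasDerivAt (fun y => dψ (y,lam)) (p (y,lam) * ψ (y,lam)) y)
    (hpos : ∀ y, 0 < y → y ≤ y0 → 0 < ψ (y,lam)) :
    ∀ y ∈ Ioc 0 L, 0 < ψ (y,lam)^2 + dψ (y,lam)^2 := by
  intro y hy
  rcases le_total y y0 with hle | hle
  · have := hpos y hy.1 hle; positivity
  · have hpc : ContinuousOn (fun y => p (y,lam)) (Icc y0 y) := by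
      apply hp.comp (f := fun y => (y,lam)) (by fun_prop)
      intro z hz; exact ⟨hy0.trans_le hz.1, mem_univ _⟩
    obtain ⟨P, hP⟩ := isCompact_Icc.exists_bound_of_continuousOn hpc
    apply pos_of_deriv_ge (fun y => ψ (y,lam)^2 + dψ (y,lam)^2)
      (fun y => 2 * (1 + p (y,lam)) * ψ (y,lam) * dψ (y,lam)) y0 y (1+P) _ _ _ y ⟨hle, le_rfl⟩
    · intro z hz
      have hz0 := hy0.trans_le hz.1
      have := ((h1 z hz0).pow 2).add ((h2 z hz0).pow 2)
      refine this.congr_deriv ?_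
      simp; ring
    · intro z hz
      have hb := hP z hz
      rw [Real.norm_eq_abs, abs_le] at hb
      rw [abs_of_nonneg (by positivity)]
      nlinarith [sq_nonneg (ψ (z,lam) + dψ (z,lam)), sq_nonneg (ψ (z,lam) - dψ (z,lam)),
        mul_nonneg (by linarith [hb.1] : 0 ≤ P + p (z,lam)) (sq_nonneg (ψ (z,lam) + dψ (z,lam))),
        mul_nonneg (by linarith [hb.1] : 0 ≤ P - p (z,lam)) (sq_nonneg (ψ (z,lam) - dψ (z,lam)))]
    · have := hpos y0 hy0 le_rfl; positivity

lemma sin_sq_lip (a b : ℝ) : |sin a ^ 2 - sin b ^ 2| ≤ |a - b| := by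
  have : sin a ^ 2 - sin b ^ 2 = sin (a+b) * sin (a-b) := by
    rw [sin_add, sin_sub]
    have h1 := sin_sq_add_cos_sq a; have h2 := sin_sq_add_cos_sq b
    linear_combination (sin b ^2) * h1 - sin a^2 * h2
  rw [this, abs_mul]
  have h1 := abs_sin_le_one (a+b)
  have h2 : |sin (a-b)| ≤ |a-b| := abs_sin_le_abs
  nlinarith [abs_nonneg (sin (a-b))]

lemma prufer (s L lam1 lam2 : ℝ) (hs : 1/2 < s) (hlam : lam1 ≤ lam2) (B : ℝ → ℝ)
    (ψ dψ p : ℝ × ℝ → ℝ) (hψ : ContinuousOn ψ (Ioi 0 ×ˢ univ))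
    (hdψ : ContinuousOn dψ (Ioi 0 ×ˢ univ)) (hp : ContinuousOn p (Ioi 0 ×ˢ univ))
    (h1 : ∀ y > 0, ∀ lam, HasDerivAt (fun y => ψ (y,lam)) (dψ (y,lam)) y)
    (h2 : ∀ y > 0, ∀ lam, HasDerivAt (fun y => dψ (y,lam)) (p (y,lam) * ψ (y,lam)) y)
    (hpf : ∀ y ∈ Ioc 0 L, ∀ lam ∈ Icc lam1 lam2, p (y,lam) = s*(s-1)/y^2 + B y - lam)
    (Cb : ℝ) (hCb : ∀ y ∈ Ioc 0 L, ∀ lam ∈ Icc lam1 lam2,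
        |ψ (y,lam)| ≤ Cb * y^s ∧ |dψ (y,lam)| ≤ Cb * y^(s-1))
    (y0 : ℝ) (hy0 : 0 < y0) (hy0L : y0 ≤ L)
    (hpos : ∀ y, 0 < y → y ≤ y0 → ∀ lam ∈ Icc lam1 lam2, 0 < ψ (y,lam))
    (h : ℝ) (hh : 0 < h) :
    ∃ θ : ℝ → ℝ → ℝ,
      (∀ lam ∈ Icc lam1 lam2, ∀ y ∈ Icc y0 L, HasDerivAt (fun y => θ y lam)
        ((cos (θ y lam)^2 + (-(h^2 * p (y,lam))) * sin (θ y lam)^2)/h) y) ∧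
      (∀ lam ∈ Icc lam1 lam2, θ y0 lam ∈ Ioo 0 π) ∧
      (∀ lam ∈ Icc lam1 lam2, ψ (L,lam) = 0 ↔ sin (θ L lam) = 0) ∧
      ContinuousOn (θ L) (Icc lam1 lam2) ∧ StrictMonoOn (θ L) (Icc lam1 lam2) := by
  have hL : 0 < L := hy0.trans_le hy0L
  have hnd : ∀ lam ∈ Icc lam1 lam2, ∀ y ∈ Ioc 0 L, 0 < ψ (y,lam)^2 + h^2 * dψ (y,lam)^2 := by
    intro lam hl y hy
    have := nondegen ψ dψ p L y0 lam hy0 hp (fun y hy => h1 y hy lam) (fun y hy => h2 y hy lam)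
      (fun y h1 h2 => hpos y h1 h2 lam hl) y hy
    by_contra hcon
    have h5 : 0 < h^2 := by positivity
    have h6 := mul_nonneg h5.le (sq_nonneg (dψ (y,lam)))
    have h3 : ψ (y,lam)^2 = 0 := le_antisymm (by linarith) (sq_nonneg _)
    have h4 : 0 < dψ (y,lam)^2 := by linarith
    have := mul_pos h5 h4
    nlinarith
  set c : ℝ → ℝ := fun t => max y0 (min t L) with hc
  have hcc : Continuous c := by simp only [hc]; fun_prop
  have hcI : ∀ t, c t ∈ Icc y0 L := fun t => ⟨le_max_left _ _, max_le hy0L (min_le_right _ _)⟩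
  have hcid : ∀ t ∈ Icc y0 L, c t = t := fun t ht => by
    simp only [hc]; rw [min_eq_left ht.2, max_eq_right ht.1]
  set cl : ℝ → ℝ := fun t => max lam1 (min t lam2) with hcl
  have hclc : Continuous cl := by simp only [hcl]; fun_prop
  have hclI : ∀ t, cl t ∈ Icc lam1 lam2 :=
    fun t => ⟨le_max_left _ _, max_le hlam (min_le_right _ _)⟩
  have hclid : ∀ t ∈ Icc lam1 lam2, cl t = t := fun t ht => by
    simp only [hcl]; rw [min_eq_left ht.2, max_eq_right ht.1]
  set I : ℝ × ℝ → ℝ := fun q => h * (dψ q ^2 - p q * ψ q ^2) / (ψ q ^2 + h^2 * dψ q^2) with hI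
  set K : Set (ℝ × ℝ) := Icc y0 L ×ˢ Icc lam1 lam2 with hK
  have hKsub : K ⊆ Ioi 0 ×ˢ univ := fun q hq => ⟨hy0.trans_le hq.1.1, mem_univ _⟩
  have hIc : ContinuousOn I K := by
    have a1 := hψ.mono hKsub; have a2 := hdψ.mono hKsub; have a3 := hp.mono hKsub
    apply ContinuousOn.div
    · fun_prop
    · fun_prop
    · intro q hq; exact (hnd q.2 hq.2 q.1 ⟨hy0.trans_le hq.1.1, hq.1.2⟩).ne'
  have hFc : Continuous (fun q : ℝ × ℝ => I (c q.1, cl q.2)) :=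
    hIc.comp_continuous (f := fun q : ℝ × ℝ => (c q.1, cl q.2)) (by fun_prop)
      (fun q => ⟨hcI _, hclI _⟩)
  set θ : ℝ → ℝ → ℝ := fun y lam =>
    (π/2 - arctan (h * dψ (y0,lam) / ψ (y0,lam))) + ∫ t in y0..y, I (c t, cl lam) with hθ
  have hθd : ∀ lam ∈ Icc lam1 lam2, ∀ y ∈ Icc y0 L,
      HasDerivAt (fun y => θ y lam) (I (y,lam)) y := by
    intro lam hl y hy
    have a1 : Continuous (fun t => I (c t, cl lam)) :=
      hFc.comp (f := fun t : ℝ => (t,lam)) (by fun_prop)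
    have a2 := ((a1.integral_hasStrictDerivAt y0 y).hasDerivAt).const_add
      (π/2 - arctan (h * dψ (y0,lam) / ψ (y0,lam)))
    exact a2.congr_deriv (by rw [hcid y hy, hclid lam hl])
  have hθ0 : ∀ lam, θ y0 lam = π/2 - arctan (h * dψ (y0,lam) / ψ (y0,lam)) := by
    intro lam; simp [hθ]
  -- the angle identity
  have hang : ∀ lam ∈ Icc lam1 lam2, ∀ y ∈ Icc y0 L,
      ψ (y,lam) * cos (θ y lam) = h * dψ (y,lam) * sin (θ y lam) := by
    intro lam hl
    set Z : ℝ → ℝ := fun y => (ψ (y,lam) * cos (θ y lam) - h * dψ (y,lam) * sin (θ y lam))^2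
      / (ψ (y,lam)^2 + h^2 * dψ (y,lam)^2) with hZ
    have hZd : ∀ y ∈ Icc y0 L, HasDerivAt Z 0 y := by
      intro y hy
      have hyp : 0 < y := hy0.trans_le hy.1
      have b1 := h1 y hyp lam
      have b2 := h2 y hyp lam
      have b3 := hθd lam hl y hy
      have hne := (hnd lam hl y ⟨hyp, hy.2⟩).ne'
      have b4 := (((b1.mul b3.cos).sub ((b2.const_mul h).mul b3.sin)).pow 2).div
        ((b1.pow 2).add ((b2.pow 2).const_mul (h^2))) hne
      refine b4.congr_deriv ?_
      rw [div_eq_zero_iff]; left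
      simp only [hI, Pi.mul_apply, Pi.sub_apply, Pi.pow_apply, Pi.add_apply]
      push_cast
      field_simp
      ring
    have hZ0 : Z y0 = 0 := by
      simp only [hZ, hθ0, cos_pi_div_two_sub, sin_pi_div_two_sub]
      have hψp := hpos y0 hy0 le_rfl lam hl
      rw [sin_arctan, cos_arctan]
      have : ψ (y0,lam) * (h * dψ (y0,lam) / ψ (y0,lam) / √(1 + (h * dψ (y0,lam) / ψ (y0,lam))^2))
        - h * dψ (y0,lam) * (1 / √(1 + (h * dψ (y0,lam) / ψ (y0,lam))^2)) = 0 := by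
        field_simp; ring
      rw [this]; simp
    intro y hy
    have hc := constant_of_has_deriv_right_zero (f := Z) (a := y0) (b := L)
      (fun x hx => (hZd x hx).continuousAt.continuousWithinAt)
      (fun x hx => (hZd x (Ico_subset_Icc_self hx)).hasDerivWithinAt) y hy
    rw [hZ0] at hc
    have hne := (hnd lam hl y ⟨hy0.trans_le hy.1, hy.2⟩).ne'
    simp only [hZ, div_eq_zero_iff, hne, or_false] at hc
    have := pow_eq_zero_iff (two_ne_zero) |>.mp hc
    linarith
  have hsin : ∀ lam ∈ Icc lam1 lam2, ∀ y ∈ Icc y0 L,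
      ψ (y,lam)^2 = (ψ (y,lam)^2 + h^2 * dψ (y,lam)^2) * sin (θ y lam)^2 := by
    intro lam hl y hy
    have e := hang lam hl y hy
    have e2 : (ψ (y,lam) * cos (θ y lam))^2 = (h * dψ (y,lam) * sin (θ y lam))^2 := by rw [e]
    have e3 := sin_sq_add_cos_sq (θ y lam)
    linear_combination (-ψ (y,lam)^2) * e3 + e2
  have hθd' : ∀ lam ∈ Icc lam1 lam2, ∀ y ∈ Icc y0 L, HasDerivAt (fun y => θ y lam)
        ((cos (θ y lam)^2 + (-(h^2 * p (y,lam))) * sin (θ y lam)^2)/h) y := by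
    intro lam hl y hy
    refine (hθd lam hl y hy).congr_deriv ?_
    have e := hsin lam hl y hy
    have hne := (hnd lam hl y ⟨hy0.trans_le hy.1, hy.2⟩).ne'
    have e3 : sin (θ y lam)^2 = ψ (y,lam)^2 / (ψ (y,lam)^2 + h^2 * dψ (y,lam)^2) := by
      rw [eq_div_iff hne]; linarith
    have e4 : cos (θ y lam)^2 = 1 - sin (θ y lam)^2 := by
      have := sin_sq_add_cos_sq (θ y lam); linarith
    rw [e4, e3]; simp only [hI]; field_simp; ring
  refine ⟨θ, hθd', ?_, ?_, ?_, ?_⟩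
  · intro lam _
    rw [hθ0]
    have a1 := neg_pi_div_two_lt_arctan (h * dψ (y0,lam) / ψ (y0,lam))
    have a2 := arctan_lt_pi_div_two (h * dψ (y0,lam) / ψ (y0,lam))
    constructor <;> linarith
  · intro lam hl
    have e := hsin lam hl L ⟨hy0L, le_rfl⟩
    have hne := (hnd lam hl L ⟨hL, le_rfl⟩).ne'
    constructor
    · intro h0
      have : sin (θ L lam)^2 = 0 := by
        rw [h0] at e hne
        rcases mul_eq_zero.mp ((e.symm).trans (by simp)) with h' | h'
        · exact absurd h' hne
        · exact h'
      exact pow_eq_zero_iff (two_ne_zero) |>.mp this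
    · intro h0
      rw [h0] at e
      have : ψ (L,lam)^2 = 0 := by rw [e]; simp
      exact pow_eq_zero_iff (two_ne_zero) |>.mp this
  · have a1 : Continuous (fun lam => ∫ t in y0..L, I (c t, cl lam)) := by
      apply intervalIntegral.continuous_parametric_intervalIntegral_of_continuous'
      exact hFc.comp (f := fun q : ℝ × ℝ => (q.2, q.1)) (by fun_prop)
    have m : ∀ lam ∈ Icc lam1 lam2, (y0,lam) ∈ Ioi (0:ℝ) ×ˢ (univ : Set ℝ) :=
      fun lam _ => ⟨hy0, mem_univ _⟩
    have a2 : ContinuousOn (fun lam => ψ (y0,lam)) (Icc lam1 lam2) :=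
      hψ.comp (f := fun lam => (y0,lam)) (by fun_prop) m
    have a3 : ContinuousOn (fun lam => dψ (y0,lam)) (Icc lam1 lam2) :=
      hdψ.comp (f := fun lam => (y0,lam)) (by fun_prop) m
    apply ContinuousOn.add _ a1.continuousOn
    apply continuousOn_const.sub
    apply continuous_arctan.comp_continuousOn
    apply (continuousOn_const.mul a3).div a2
    intro lam hl; exact (hpos y0 hy0 le_rfl lam hl).ne'
  · intro la hla lb hlb hab
    -- initial angles
    have hW : 0 < dψ (y0,la) * ψ (y0,lb) - ψ (y0,la) * dψ (y0,lb) := by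
      set W : ℝ → ℝ := fun y => dψ (y,la) * ψ (y,lb) - ψ (y,la) * dψ (y,lb) with hWdef
      have hWd : ∀ y ∈ Ioc 0 y0, HasDerivAt W ((lb - la) * (ψ (y,la) * ψ (y,lb))) y := by
        intro y hy
        have := ((h2 y hy.1 la).mul (h1 y hy.1 lb)).sub ((h1 y hy.1 la).mul (h2 y hy.1 lb))
        refine this.congr_deriv ?_
        rw [hpf y ⟨hy.1, hy.2.trans hy0L⟩ la hla, hpf y ⟨hy.1, hy.2.trans hy0L⟩ lb hlb]
        ring
      have hmono : StrictMonoOn W (Ioc 0 y0) := by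
        apply strictMonoOn_of_deriv_pos (convex_Ioc 0 y0)
        · intro y hy; exact (hWd y hy).continuousAt.continuousWithinAt
        · intro y hy
          rw [interior_Ioc] at hy
          rw [(hWd y ⟨hy.1, hy.2.le⟩).deriv]
          have q1 := hpos y hy.1 hy.2.le la hla
          have q2 := hpos y hy.1 hy.2.le lb hlb
          have : 0 < lb - la := by linarith
          positivity
      have hlim : Tendsto W (𝓝[>] 0) (𝓝 0) := by
        apply squeeze_zero_norm' (a := fun y => 2*Cb^2 * y ^ (2*s-1))
        · filter_upwards [Ioc_mem_nhdsGT hL] with y hy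
          obtain ⟨q1, q2⟩ := hCb y hy la hla
          obtain ⟨q3, q4⟩ := hCb y hy lb hlb
          have e : y ^ (s-1) * y ^ s = y ^ (2*s-1) := by
            rw [← Real.rpow_add hy.1]; congr 1; ring
          calc ‖W y‖ ≤ |dψ (y,la)| * |ψ (y,lb)| + |ψ (y,la)| * |dψ (y,lb)| := by
                rw [← abs_mul, ← abs_mul]; exact abs_sub _ _
            _ ≤ (Cb * y^(s-1)) * (Cb * y^s) + (Cb*y^s) * (Cb * y^(s-1)) :=
                add_le_add (mul_le_mul q2 q3 (abs_nonneg _) ((abs_nonneg _).trans q2))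
                  (mul_le_mul q1 q4 (abs_nonneg _) ((abs_nonneg _).trans q1))
            _ = _ := by rw [← e]; ring
        · have : Continuous (fun y : ℝ => 2*Cb^2 * y ^ (2*s-1)) :=
            continuous_const.mul (Real.continuous_rpow_const (by linarith))
          have := this.tendsto 0
          rw [Real.zero_rpow (by linarith), mul_zero] at this
          exact this.mono_left nhdsWithin_le_nhds
      have hhalf : 0 ≤ W (y0/2) := by
        apply le_of_tendsto hlim
        filter_upwards [Ioc_mem_nhdsGT (show (0:ℝ) < y0/2 by linarith)] with y hy
        exact hmono.monotoneOn ⟨hy.1, by linarith [hy.2]⟩ ⟨by linarith, by linarith⟩ hy.2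
      exact hhalf.trans_lt (hmono ⟨by linarith, by linarith⟩ ⟨hy0, le_rfl⟩ (by linarith))
    have hinit : 0 < θ y0 lb - θ y0 la := by
      rw [hθ0, hθ0]
      have pa := hpos y0 hy0 le_rfl la hla
      have pb := hpos y0 hy0 le_rfl lb hlb
      have : h * dψ (y0,lb) / ψ (y0,lb) < h * dψ (y0,la) / ψ (y0,la) := by
        rw [div_lt_div_iff₀ pb pa]; nlinarith
      have := arctan_strictMono this
      linarith
    have hpc : ContinuousOn (fun y => p (y,lb)) (Icc y0 L) := by
      apply hp.comp (f := fun y => (y,lb)) (by fun_prop)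
      intro z hz; exact ⟨hy0.trans_le hz.1, mem_univ _⟩
    obtain ⟨P, hP⟩ := isCompact_Icc.exists_bound_of_continuousOn hpc
    have := pos_of_deriv_ge (fun y => θ y lb - θ y la) _ y0 L ((h^2*P+1)/h)
      (fun y hy => (hθd' lb hlb y hy).sub (hθd' la hla y hy)) ?_ hinit L ⟨hy0L, le_rfl⟩
    · linarith
    · intro y hy
      have hpb := hP y hy
      rw [Real.norm_eq_abs] at hpb
      have hy' : y ∈ Ioc 0 L := ⟨hy0.trans_le hy.1, hy.2⟩
      have hpa : p (y,la) = p (y,lb) + (lb - la) := by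
        rw [hpf y hy' la hla, hpf y hy' lb hlb]; ring
      have hl := sin_sq_lip (θ y lb) (θ y la)
      have e1 : cos (θ y lb)^2 = 1 - sin (θ y lb)^2 := by
        have := sin_sq_add_cos_sq (θ y lb); linarith
      have e2 : cos (θ y la)^2 = 1 - sin (θ y la)^2 := by
        have := sin_sq_add_cos_sq (θ y la); linarith
      rw [← sub_div, neg_mul, div_mul_eq_mul_div, ← neg_div]
      apply div_le_div_of_nonneg_right _ hh.le
      rw [e1, e2, hpa]
      set d := sin (θ y lb)^2 - sin (θ y la)^2 with hd
      have e3 : (1 + h^2 * p (y,lb)) * d ≤ (h^2*P+1) * |θ y lb - θ y la| := by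
        calc _ ≤ |(1 + h^2 * p (y,lb)) * d| := le_abs_self _
          _ = |1 + h^2 * p (y,lb)| * |d| := abs_mul _ _
          _ ≤ _ := by
            apply mul_le_mul _ hl (abs_nonneg _) _
            · calc _ ≤ |(1:ℝ)| + |h^2 * p (y,lb)| := abs_add_le _ _
                _ ≤ _ := by
                  rw [abs_one, abs_mul, abs_of_nonneg (sq_nonneg h)]
                  nlinarith [mul_le_mul_of_nonneg_left hpb (sq_nonneg h)]
            · have := (abs_nonneg _).trans hpb; positivity
      have e4 : 0 ≤ h^2 * (lb - la) * sin (θ y la)^2 := by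
        have : 0 ≤ lb - la := by linarith
        positivity
      nlinarith

noncomputable def phik (k t : ℝ) : ℝ :=
  t + arctan (((k-1) * (sin t * cos t)) / (cos t^2 + k * sin t^2))

lemma den_pos (k t : ℝ) (hk : 0 < k) : 0 < cos t^2 + k * sin t^2 := by
  have h := sin_sq_add_cos_sq t
  rcases (sq_nonneg (sin t)).eq_or_lt with h0 | h0
  · rw [← h0] at h ⊢; linarith
  · have := mul_pos hk h0; nlinarith [sq_nonneg (cos t)]

lemma phik_hasDerivAt (k t : ℝ) (hk : 0 < k) :
    HasDerivAt (phik k) (k / (cos t^2 + k^2 * sin t^2)) t := by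
  have hd := den_pos k t hk
  have hd2 := den_pos (k^2) t (by positivity)
  have h1 : HasDerivAt (fun t => ((k-1) * (sin t * cos t))) ((k-1) * (cos t * cos t + sin t * (-sin t))) t :=
    ((hasDerivAt_sin t).mul (hasDerivAt_cos t)).const_mul (k-1)
  have h2 : HasDerivAt (fun t => cos t^2 + k * sin t^2) (2 * (k-1) * sin t * cos t) t := by
    refine (((hasDerivAt_cos t).pow 2).add (((hasDerivAt_sin t).pow 2).const_mul k)).congr_deriv ?_
    simp; ring
  have h3 := (hasDerivAt_id t).add (h1.div h2 hd.ne').arctan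
  refine h3.congr_deriv ?_
  have e := sin_sq_add_cos_sq t
  simp only [Pi.div_apply]
  set s := sin t
  set c := cos t
  have hs : s^2 = 1 - c^2 := by linarith
  have e1 : (c^2 + k*s^2)^2 + ((k-1)*(s*c))^2 = c^2 + k^2*s^2 := by
    have : (c^2 + k*s^2)^2 + ((k-1)*(s*c))^2 = (c^2 + k^2*s^2) * (s^2+c^2) := by ring
    rw [this, e, mul_one]
  have e2 : 1 + ((k-1)*(s*c) / (c^2 + k*s^2))^2 = (c^2 + k^2*s^2) / (c^2+k*s^2)^2 := by
    rw [← e1]; field_simp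
  rw [e2]
  have e3 : (k-1) * (c*c + s*(-s)) * (c^2+k*s^2) - (k-1)*(s*c)*(2*(k-1)*s*c)
      = (k-1)*(c^2 - k*s^2) := by
    have : (k-1) * (c*c + s*(-s)) * (c^2+k*s^2) - (k-1)*(s*c)*(2*(k-1)*s*c)
      = (k-1)*(c^2 - k*s^2) * (s^2+c^2) := by ring
    rw [this, e, mul_one]
  rw [e3]
  field_simp
  linear_combination k * e

lemma phik_near (k t : ℝ) : |phik k t - t| ≤ π/2 := by
  unfold phik
  rw [add_sub_cancel_left, abs_le]
  exact ⟨(neg_pi_div_two_lt_arctan _).le, (arctan_lt_pi_div_two _).le⟩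

lemma rot_upper (θ K : ℝ → ℝ) (c d h k : ℝ) (hcd : c ≤ d) (hh : 0 < h) (hk : 0 < k)
    (hθ : ∀ y ∈ Icc c d, HasDerivAt θ ((cos (θ y)^2 + K y * sin (θ y)^2)/h) y)
    (hK : ∀ y ∈ Icc c d, K y ≤ k^2) :
    θ d - θ c ≤ k * (d-c) / h + π := by
  have hd : ∀ y ∈ Icc c d, HasDerivAt (fun y => phik k (θ y)) _ y := fun y hy =>
    (phik_hasDerivAt k (θ y) hk).comp y (hθ y hy)
  have := (convex_Icc c d).image_sub_le_mul_sub_of_deriv_le (f := fun y => phik k (θ y)) (C := k/h)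
    (fun y hy => (hd y hy).continuousAt.continuousWithinAt)
    (fun y hy => (hd y (interior_subset hy)).differentiableAt.differentiableWithinAt)
    (fun y hy => by
      have hy' := interior_subset hy
      rw [(hd y hy').deriv]
      have hp := den_pos (k^2) (θ y) (by positivity)
      rw [div_mul_div_comm, div_le_div_iff₀ (by positivity) hh]
      have : cos (θ y)^2 + K y * sin (θ y)^2 ≤ cos (θ y)^2 + k^2 * sin (θ y)^2 := by
        have := mul_le_mul_of_nonneg_right (hK y hy') (sq_nonneg (sin (θ y)))
        linarith
      calc _ = (k * h) * (cos (θ y)^2 + K y * sin (θ y)^2) := by ring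
        _ ≤ (k * h) * (cos (θ y)^2 + k^2 * sin (θ y)^2) :=
          mul_le_mul_of_nonneg_left this (by positivity)
        _ = _ := by ring)
    c ⟨le_rfl, hcd⟩ d ⟨hcd, le_rfl⟩ hcd
  have h1 := abs_le.mp (phik_near k (θ d))
  have h2 := abs_le.mp (phik_near k (θ c))
  have e : k * (d-c)/h = k/h*(d-c) := by ring
  rw [e]; linarith [h1.1, h2.2]

lemma rot_lower (θ K : ℝ → ℝ) (c d h k : ℝ) (hcd : c ≤ d) (hh : 0 < h) (hk : 0 < k)
    (hθ : ∀ y ∈ Icc c d, HasDerivAt θ ((cos (θ y)^2 + K y * sin (θ y)^2)/h) y)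
    (hK : ∀ y ∈ Icc c d, k^2 ≤ K y) :
    k * (d-c) / h - π ≤ θ d - θ c := by
  have hd : ∀ y ∈ Icc c d, HasDerivAt (fun y => phik k (θ y)) _ y := fun y hy =>
    (phik_hasDerivAt k (θ y) hk).comp y (hθ y hy)
  have := (convex_Icc c d).mul_sub_le_image_sub_of_le_deriv (f := fun y => phik k (θ y)) (C := k/h)
    (fun y hy => (hd y hy).continuousAt.continuousWithinAt)
    (fun y hy => (hd y (interior_subset hy)).differentiableAt.differentiableWithinAt)
    (fun y hy => by
      have hy' := interior_subset hy
      rw [(hd y hy').deriv]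
      have hp := den_pos (k^2) (θ y) (by positivity)
      rw [div_mul_div_comm, div_le_div_iff₀ hh (by positivity)]
      have : cos (θ y)^2 + k^2 * sin (θ y)^2 ≤ cos (θ y)^2 + K y * sin (θ y)^2 := by
        have := mul_le_mul_of_nonneg_right (hK y hy') (sq_nonneg (sin (θ y)))
        linarith
      calc _ = (k * h) * (cos (θ y)^2 + k^2 * sin (θ y)^2) := by ring
        _ ≤ (k * h) * (cos (θ y)^2 + K y * sin (θ y)^2) :=
          mul_le_mul_of_nonneg_left this (by positivity)
        _ = _ := by ring)
    c ⟨le_rfl, hcd⟩ d ⟨hcd, le_rfl⟩ hcd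
  have h1 := abs_le.mp (phik_near k (θ d))
  have h2 := abs_le.mp (phik_near k (θ c))
  have e : k * (d-c)/h = k/h*(d-c) := by ring
  rw [e]; linarith [h1.2, h2.1]

lemma rot_ge (θ K : ℝ → ℝ) (c d h : ℝ) (hcd : c ≤ d) (hh : 0 < h)
    (hθ : ∀ y ∈ Icc c d, HasDerivAt θ ((cos (θ y)^2 + K y * sin (θ y)^2)/h) y) :
    -π ≤ θ d - θ c := by
  set n : ℤ := ⌊θ c / π⌋ with hn
  have hpi := pi_pos
  have h1 : (n:ℝ) * π ≤ θ c := by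
    have := Int.floor_le (θ c / π); rwa [le_div_iff₀ hpi] at this
  have h2 : θ c < (n+1) * π := by
    have := Int.lt_floor_add_one (θ c / π); rwa [div_lt_iff₀ hpi] at this
  have key := image_le_of_deriv_right_lt_deriv_boundary (f := fun y => - θ y)
    (f' := fun y => - ((cos (θ y)^2 + K y * sin (θ y)^2)/h)) (a := c) (b := d)
    (B := fun _ => -(n * π)) (B' := fun _ => 0)
    (fun x hx => (hθ x hx).continuousAt.neg.continuousWithinAt)
    (fun x hx => (hθ x (Ico_subset_Icc_self hx)).neg.hasDerivWithinAt)
    (by linarith)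
    (fun x => hasDerivAt_const x _)
    (fun x hx he => by
      have he' : θ x = n * π := neg_injective he
      have e0 : sin (θ x) = 0 := by rw [he']; exact sin_int_mul_pi n
      have e1 := sin_sq_add_cos_sq (θ x)
      rw [e0] at e1 ⊢
      have e2 : cos (θ x)^2 = 1 := by linarith
      rw [e2]
      have : (0:ℝ) < 1/h := by positivity
      simp; exact hh)
    (show d ∈ Icc c d from ⟨hcd, le_rfl⟩)
  nlinarith

lemma rot_piece (θ K U : ℝ → ℝ) (c d h m η : ℝ) (hcd : c ≤ d) (hh : 0 < h) (hm : 0 ≤ m)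
    (hη : 0 < η)
    (hθ : ∀ y ∈ Icc c d, HasDerivAt θ ((cos (θ y)^2 + K y * sin (θ y)^2)/h) y)
    (hS : ∀ y ∈ Icc c d, |√(max 0 (U y)) - m| ≤ η)
    (hK : ∀ y ∈ Icc c d, |K y - U y| ≤ η^2) :
    |h * (θ d - θ c) - m * (d-c)| ≤ 2*η*(d-c) + π*h := by
  have hpi := pi_pos
  have hdc : 0 ≤ d - c := by linarith
  rw [abs_le]
  constructor
  · have hmain : (m - 2*η) * (d-c) / h - π ≤ θ d - θ c := by
      rcases le_or_gt m (2*η) with hle | hlt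
      · have h1 := rot_ge θ K c d h hcd hh hθ
        have : (m - 2*η) * (d-c) / h ≤ 0 :=
          div_nonpos_of_nonpos_of_nonneg (mul_nonpos_of_nonpos_of_nonneg (by linarith) hdc) hh.le
        linarith
      · apply rot_lower θ K c d h (m-2*η) hcd hh (by linarith) hθ
        intro y hy
        have h1 := (abs_le.mp (hS y hy)).1
        have h2 := (abs_le.mp (hK y hy)).1
        have h3 : 0 < √(max 0 (U y)) := by linarith
        have h4 : 0 < max 0 (U y) := Real.sqrt_pos.mp h3
        have h5 : max 0 (U y) = U y := by
          rcases max_choice 0 (U y) with h' | h'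
          · rw [h'] at h4; exact absurd h4 (lt_irrefl _)
          · exact h'
        have h6 := Real.sq_sqrt h4.le
        rw [h5] at h6 h1 h3
        nlinarith
    have h2 := mul_le_mul_of_nonneg_left hmain hh.le
    have e : h * ((m - 2*η) * (d-c) / h - π) = (m-2*η)*(d-c) - π*h := by field_simp
    rw [e] at h2; nlinarith
  · have hmain : θ d - θ c ≤ (m + 2*η) * (d-c) / h + π := by
      apply rot_upper θ K c d h (m+2*η) hcd hh (by linarith) hθ
      intro y hy
      have h1 := (abs_le.mp (hS y hy)).2
      have h2 := (abs_le.mp (hK y hy)).2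
      have h6 := Real.sq_sqrt (le_max_left 0 (U y))
      have h7 := le_max_right 0 (U y)
      have h8 := Real.sqrt_nonneg (max 0 (U y))
      nlinarith
    have h2 := mul_le_mul_of_nonneg_left hmain hh.le
    have e : h * ((m + 2*η) * (d-c) / h + π) = (m+2*η)*(d-c) + π*h := by field_simp
    rw [e] at h2; nlinarith

lemma count_lemma (f : ℝ → ℝ) (a b : ℝ) (hab : a ≤ b) (hf : ContinuousOn f (Icc a b))
    (hm : StrictMonoOn f (Icc a b)) :
    {x | x ∈ Icc a b ∧ sin (f x) = 0}.Finite ∧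
    |π * ({x | x ∈ Icc a b ∧ sin (f x) = 0}.ncard : ℝ) - (f b - f a)| ≤ π := by
  set T := {x | x ∈ Icc a b ∧ sin (f x) = 0} with hT
  have hpi := pi_pos
  have hfab : f a ≤ f b := hm.monotoneOn ⟨le_rfl, hab⟩ ⟨hab, le_rfl⟩ hab
  set F : Finset ℤ := Finset.Icc ⌈f a / π⌉ ⌊f b / π⌋ with hF
  have himg : f '' T = (fun n : ℤ => (n:ℝ) * π) '' (F : Set ℤ) := by
    ext z; constructor
    · rintro ⟨x, ⟨hx, hs⟩, rfl⟩
      obtain ⟨n, hn⟩ := sin_eq_zero_iff.mp hs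
      refine ⟨n, ?_, hn⟩
      have h1 := hm.monotoneOn ⟨le_rfl, hab⟩ hx hx.1
      have h2 := hm.monotoneOn hx ⟨hab, le_rfl⟩ hx.2
      simp only [hF, Finset.coe_Icc, mem_Icc]
      constructor
      · rw [Int.ceil_le, div_le_iff₀ hpi, hn]; exact h1
      · rw [Int.le_floor, le_div_iff₀ hpi, hn]; exact h2
    · rintro ⟨n, hn, rfl⟩
      simp only [hF, Finset.coe_Icc, mem_Icc] at hn
      rw [Int.ceil_le, div_le_iff₀ hpi, Int.le_floor, le_div_iff₀ hpi] at hn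
      obtain ⟨x, hx, hxe⟩ := intermediate_value_Icc hab hf hn
      exact ⟨x, ⟨hx, by rw [hxe]; exact sin_int_mul_pi n⟩, hxe⟩
  have hinj : InjOn f T := hm.injOn.mono (fun x hx => hx.1)
  have hinj2 : Function.Injective (fun n : ℤ => (n:ℝ) * π) := by
    intro p q hpq
    have := mul_right_cancel₀ hpi.ne' hpq
    exact_mod_cast this
  have hfin : T.Finite := by
    apply Set.Finite.of_finite_image _ hinj
    rw [himg]; exact F.finite_toSet.image _
  refine ⟨hfin, ?_⟩
  have hcard : T.ncard = (⌊f b / π⌋ + 1 - ⌈f a / π⌉).toNat := by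
    rw [← Set.InjOn.ncard_image hinj, himg, Set.ncard_image_of_injective _ hinj2,
      Set.ncard_coe_finset, hF, Int.card_Icc]
  have c1 := Int.lt_floor_add_one (f b / π)
  have c2 := Int.floor_le (f b / π)
  have c3 := Int.le_ceil (f a / π)
  have c4 := Int.ceil_lt_add_one (f a / π)
  have c5 : f a / π ≤ f b / π := div_le_div_of_nonneg_right hfab hpi.le
  have hnn : 0 ≤ ⌊f b / π⌋ + 1 - ⌈f a / π⌉ := by
    have : (-1:ℝ) < ((⌊f b / π⌋ + 1 - ⌈f a / π⌉ : ℤ) : ℝ) := by push_cast; linarith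
    have : (-1:ℤ) < ⌊f b / π⌋ + 1 - ⌈f a / π⌉ := by exact_mod_cast this
    linarith
  have hcr : (T.ncard : ℝ) = ⌊f b / π⌋ + 1 - ⌈f a / π⌉ := by
    rw [hcard]
    have := Int.toNat_of_nonneg hnn
    have h2 : (((⌊f b / π⌋ + 1 - ⌈f a / π⌉).toNat : ℤ) : ℝ) =
      ((⌊f b / π⌋ + 1 - ⌈f a / π⌉ : ℤ) : ℝ) := by rw [this]
    push_cast at h2
    exact_mod_cast h2
  have e1 : f b - f a = π * (f b / π - f a / π) := by field_simp
  rw [hcr, e1, ← mul_sub, abs_mul, abs_of_pos hpi]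
  have : |(⌊f b / π⌋:ℝ) + 1 - ⌈f a / π⌉ - (f b / π - f a / π)| ≤ 1 := by
    rw [abs_le]; constructor <;> linarith
  nlinarith

/-- Rotation over a fixed interval, via a uniform partition. -/
lemma rot_sum (θ K U : ℝ → ℝ) (c d h η : ℝ) (n : ℕ) (hn : 0 < n) (hcd : c ≤ d) (hh : 0 < h)
    (hη : 0 < η)
    (hθ : ∀ y ∈ Icc c d, HasDerivAt θ ((cos (θ y)^2 + K y * sin (θ y)^2)/h) y)
    (hSc : ContinuousOn (fun y => √(max 0 (U y))) (Icc c d))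
    (hS : ∀ y ∈ Icc c d, ∀ z ∈ Icc c d, |y - z| ≤ (d-c)/n →
      |√(max 0 (U y)) - √(max 0 (U z))| ≤ η)
    (hK : ∀ y ∈ Icc c d, |K y - U y| ≤ η^2) :
    |h * (θ d - θ c) - ∫ y in c..d, √(max 0 (U y))| ≤ 3*η*(d-c) + n * (π*h) := by
  set S : ℝ → ℝ := fun y => √(max 0 (U y)) with hSdef
  have hn' : (0:ℝ) < n := by exact_mod_cast hn
  set w := (d-c)/n with hw
  have hw0 : 0 ≤ w := div_nonneg (by linarith) hn'.le
  set t : ℕ → ℝ := fun i => c + i * w with ht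
  have ht0 : t 0 = c := by simp [ht]
  have htn : t n = d := by simp only [ht, hw]; field_simp; ring
  have htm : ∀ i j : ℕ, i ≤ j → t i ≤ t j := by
    intro i j hij
    simp only [ht]
    have : (i:ℝ) ≤ j := by exact_mod_cast hij
    nlinarith
  have hts : ∀ i : ℕ, t (i+1) - t i = w := by intro i; simp only [ht]; push_cast; ring
  have hsub : ∀ i < n, Icc (t i) (t (i+1)) ⊆ Icc c d := by
    intro i hi
    apply Icc_subset_Icc
    · rw [← ht0]; exact htm _ _ (Nat.zero_le _)
    · rw [← htn]; exact htm _ _ hi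
  have hpiece : ∀ i < n, |h * (θ (t (i+1)) - θ (t i)) - ∫ y in (t i)..(t (i+1)), S y|
      ≤ 3*η*w + π*h := by
    intro i hi
    have hle : t i ≤ t (i+1) := htm _ _ (Nat.le_succ i)
    have hmem : t i ∈ Icc c d := hsub i hi ⟨le_rfl, hle⟩
    have hosc : ∀ y ∈ Icc (t i) (t (i+1)), |S y - S (t i)| ≤ η := by
      intro y hy
      apply hS y (hsub i hi hy) _ hmem
      rw [abs_of_nonneg (by linarith [hy.1])]
      have := hts i
      linarith [hy.2]
    have h1 := rot_piece θ K U (t i) (t (i+1)) h (S (t i)) η hle hh (Real.sqrt_nonneg _) hη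
      (fun y hy => hθ y (hsub i hi hy)) hosc (fun y hy => hK y (hsub i hi hy))
    have hItg : IntervalIntegrable S volume (t i) (t (i+1)) := by
      apply ContinuousOn.intervalIntegrable
      rw [uIcc_of_le hle]
      exact hSc.mono (hsub i hi)
    have h2 : |(∫ y in (t i)..(t (i+1)), S y) - S (t i) * (t (i+1) - t i)| ≤ η * w := by
      have e : (∫ y in (t i)..(t (i+1)), S y) - S (t i) * (t (i+1) - t i) =
          ∫ y in (t i)..(t (i+1)), (S y - S (t i)) := by
        rw [intervalIntegral.integral_sub hItg (by simp)]
        simp; ring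
      rw [e]
      have := intervalIntegral.norm_integral_le_of_norm_le_const (a := t i) (b := t (i+1))
        (C := η) (f := fun y => S y - S (t i)) (fun y hy => by
          rw [uIoc_of_le hle] at hy
          exact hosc y ⟨hy.1.le, hy.2⟩)
      rw [hts i, abs_of_nonneg hw0] at this
      exact this
    rw [hts i] at h1 h2
    rw [abs_le] at h1 h2 ⊢
    constructor <;> linarith [h1.1, h1.2, h2.1, h2.2]
  have e1 : θ d - θ c = ∑ i ∈ Finset.range n, (θ (t (i+1)) - θ (t i)) := by
    rw [Finset.sum_range_sub (fun i => θ (t i)), ht0, htn]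
  have e2 : ∫ y in c..d, S y = ∑ i ∈ Finset.range n, ∫ y in (t i)..(t (i+1)), S y := by
    rw [intervalIntegral.sum_integral_adjacent_intervals, ht0, htn]
    intro k hk
    apply ContinuousOn.intervalIntegrable
    rw [uIcc_of_le (htm _ _ (Nat.le_succ k))]
    exact hSc.mono (hsub k hk)
  rw [e1, e2, Finset.mul_sum, ← Finset.sum_sub_distrib]
  calc _ ≤ ∑ i ∈ Finset.range n, |h * (θ (t (i+1)) - θ (t i)) - ∫ y in (t i)..(t (i+1)), S y| :=
        Finset.abs_sum_le_sum_abs _ _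
    _ ≤ ∑ i ∈ Finset.range n, (3*η*w + π*h) :=
        Finset.sum_le_sum (fun i hi => hpiece i (Finset.mem_range.mp hi))
    _ = _ := by
        rw [Finset.sum_const, Finset.card_range, nsmul_eq_mul, hw]; field_simp

set_option maxHeartbeats 1000000 in
lemma angle_asymp (L c0 h1 M0 M1 : ℝ) (hL : 0 < L) (hc0 : 0 < c0) (hh1 : 0 < h1) (hM1 : 0 < M1)
    (U : ℝ → ℝ) (hU : ContinuousOn U (Ioc 0 L)) (hUb : ∀ y ∈ Ioc 0 L, |U y| ≤ M0)
    (K θ : ℝ → ℝ → ℝ)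
    (hKb : ∀ h ∈ Ioo 0 h1, ∀ y ∈ Icc (c0*h) L, K h y ≤ M1^2)
    (hKl : ∀ ε > 0, ∀ η > 0, ∃ h2 > 0, ∀ h ∈ Ioo 0 h2, ∀ y ∈ Icc ε L, |K h y - U y| ≤ η)
    (hθ : ∀ h ∈ Ioo 0 h1, ∀ y ∈ Icc (c0*h) L,
      HasDerivAt (θ h) ((cos (θ h y)^2 + K h y * sin (θ h y)^2)/h) y)
    (hθ0 : ∀ h ∈ Ioo 0 h1, θ h (c0*h) ∈ Ioo 0 π) :
    Tendsto (fun h => h * θ h L) (𝓝[>] 0) (𝓝 (∫ y in (0:ℝ)..L, √(max 0 (U y)))) := by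
  have hpi := pi_pos
  set S : ℝ → ℝ := fun y => √(max 0 (U y)) with hS
  have hM0 : 0 ≤ M0 := (abs_nonneg _).trans (hUb L ⟨hL, le_rfl⟩)
  have hSc : ContinuousOn S (Ioc 0 L) := by
    simp only [hS]
    exact (continuousOn_const.sup hU).sqrt
  have hSb : ∀ y ∈ Ioc 0 L, |S y| ≤ √M0 := by
    intro y hy
    rw [abs_of_nonneg (Real.sqrt_nonneg _)]
    apply Real.sqrt_le_sqrt
    exact max_le hM0 ((le_abs_self _).trans (hUb y hy))
  have hSint : IntegrableOn S (Ioc 0 L) := by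
    have hc : IntegrableOn (fun _ : ℝ => √M0) (Ioc 0 L) := by simp
    refine Integrable.mono' hc (hSc.aestronglyMeasurable measurableSet_Ioc) ?_
    rw [ae_restrict_iff' measurableSet_Ioc]
    filter_upwards with y hy using hSb y hy
  have hSii : ∀ ε ∈ Icc 0 L, IntervalIntegrable S volume 0 ε ∧ IntervalIntegrable S volume ε L := by
    intro ε hε
    constructor
    · rw [intervalIntegrable_iff_integrableOn_Ioc_of_le hε.1]
      exact hSint.mono_set (Ioc_subset_Ioc_right hε.2)
    · rw [intervalIntegrable_iff_integrableOn_Ioc_of_le hε.2]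
      exact hSint.mono_set (Ioc_subset_Ioc_left hε.1)
  rw [Metric.tendsto_nhdsWithin_nhds]
  intro e he
  -- choose ε
  set Q := M1 + √M0 with hQ
  have hQ0 : 0 < Q := by positivity
  set ε := min (L/2) (e / (8*Q)) with hε
  have hε0 : 0 < ε := by positivity
  have hεL : ε < L := (min_le_left _ _).trans_lt (by linarith)
  have hεQ : Q * ε ≤ e/8 := by
    have : ε ≤ e / (8*Q) := min_le_right _ _
    calc Q * ε ≤ Q * (e/(8*Q)) := mul_le_mul_of_nonneg_left this hQ0.le
      _ = e/8 := by field_simp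
  set η := e / (24*L) with hη
  have hη0 : 0 < η := by positivity
  have hηL : 3*η*L = e/8 := by rw [hη]; field_simp; norm_num
  have hSc' : ContinuousOn S (Icc ε L) := hSc.mono (fun y hy => ⟨hε0.trans_le hy.1, hy.2⟩)
  have huc := isCompact_Icc.uniformContinuousOn_of_continuous hSc'
  rw [Metric.uniformContinuousOn_iff_le] at huc
  obtain ⟨d, hd, hdS⟩ := huc η hη0
  obtain ⟨n, hn⟩ := exists_nat_gt ((L-ε)/d)
  have hn0 : (0:ℝ) < n := lt_of_le_of_lt (div_nonneg (by linarith) hd.le) hn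
  have hnN : 0 < n := by exact_mod_cast hn0
  have hnd : (L-ε)/n ≤ d := by
    rw [div_le_iff₀ hn0]; rw [div_lt_iff₀ hd] at hn; linarith
  obtain ⟨h2, hh2, hK2⟩ := hKl ε hε0 (η^2) (by positivity)
  set h3 := min (min h1 h2) (min (ε/c0) (e / (8*(n+2)*π))) with hh3
  refine ⟨h3, by positivity, ?_⟩
  intro h hh hhd
  simp only [mem_Ioi] at hh
  rw [Real.dist_eq, sub_zero, abs_of_pos hh] at hhd
  have a1 : h < h1 := hhd.trans_le ((min_le_left _ _).trans (min_le_left _ _))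
  have a2 : h < h2 := hhd.trans_le ((min_le_left _ _).trans (min_le_right _ _))
  have a3 : c0 * h ≤ ε := by
    have : h < ε/c0 := hhd.trans_le ((min_le_right _ _).trans (min_le_left _ _))
    rw [lt_div_iff₀ hc0] at this; linarith
  have a4 : (n+2) * (π*h) ≤ e/8 := by
    have : h < e / (8*(n+2)*π) := hhd.trans_le ((min_le_right _ _).trans (min_le_right _ _))
    rw [lt_div_iff₀ (by positivity)] at this
    have e1 : h * (8*((n:ℝ)+2)*π) = 8 * ((n+2) * (π*h)) := by ring
    rw [e1] at this; linarith
  have b1 := rot_sum (θ h) (K h) U ε L h η n hnN hεL.le hh hη0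
    (fun y hy => hθ h ⟨hh, a1⟩ y ⟨a3.trans hy.1, hy.2⟩) hSc'
    (fun y hy z hz hyz => by
      have := hdS y hy z hz (by rw [Real.dist_eq]; exact hyz.trans hnd)
      rwa [Real.dist_eq] at this)
    (fun y hy => hK2 h ⟨hh, a2⟩ y hy)
  have b1 : |h * (θ h L - θ h ε) - ∫ y in ε..L, S y| ≤ 3*η*(L-ε) + n * (π*h) := b1
  have b2 := rot_upper (θ h) (K h) (c0*h) ε h M1 a3 hh hM1
    (fun y hy => hθ h ⟨hh, a1⟩ y ⟨hy.1, hy.2.trans hεL.le⟩)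
    (fun y hy => hKb h ⟨hh, a1⟩ y ⟨hy.1, hy.2.trans hεL.le⟩)
  have b3 := rot_ge (θ h) (K h) (c0*h) ε h a3 hh
    (fun y hy => hθ h ⟨hh, a1⟩ y ⟨hy.1, hy.2.trans hεL.le⟩)
  have b4 := hθ0 h ⟨hh, a1⟩
  have b5 : |∫ y in (0:ℝ)..ε, S y| ≤ √M0 * ε := by
    have := intervalIntegral.norm_integral_le_of_norm_le_const (a := (0:ℝ)) (b := ε)
      (C := √M0) (f := S) (fun y hy => by
        rw [uIoc_of_le hε0.le] at hy
        exact hSb y ⟨hy.1, hy.2.trans hεL.le⟩)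
    rwa [sub_zero, abs_of_pos hε0] at this
  have b6 : ∫ y in (0:ℝ)..L, S y = (∫ y in (0:ℝ)..ε, S y) + ∫ y in ε..L, S y :=
    (intervalIntegral.integral_add_adjacent_intervals (hSii ε ⟨hε0.le, hεL.le⟩).1
      (hSii ε ⟨hε0.le, hεL.le⟩).2).symm
  have c1 : h * (θ h ε - θ h (c0*h)) ≤ M1 * ε + π * h := by
    have := mul_le_mul_of_nonneg_left b2 hh.le
    have e1 : h * (M1 * (ε - c0*h)/h + π) = M1 * (ε - c0*h) + π*h := by field_simp
    rw [e1] at this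
    have h9 : 0 ≤ M1 * (c0*h) := by positivity
    have e2 : M1 * (ε - c0*h) = M1*ε - M1*(c0*h) := by ring
    rw [e2] at this
    linarith
  have c2 : -(π*h) ≤ h * (θ h ε - θ h (c0*h)) := by
    have := mul_le_mul_of_nonneg_left b3 hh.le
    linarith
  have c3 : h * θ h (c0*h) ≤ π * h := by
    have := mul_le_mul_of_nonneg_left b4.2.le hh.le
    linarith
  have c4 : 0 ≤ h * θ h (c0*h) := mul_nonneg hh.le b4.1.le
  have c5 : 0 ≤ M1 * ε := by positivity
  have c6 : 0 ≤ √M0 * ε := by positivity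
  have c7 : 0 ≤ 3*η*ε := by positivity
  have c8 : Q * ε = M1 * ε + √M0 * ε := by rw [hQ]; ring
  rw [Real.dist_eq, b6]
  rw [abs_le] at b1 b5
  have d1 := b1.1
  have d2 := b1.2
  have d3 := b5.1
  have d4 := b5.2
  rw [abs_lt]
  have f1 : 3*η*(L-ε) = 3*η*L - 3*η*ε := by ring
  have f2 : ((n:ℝ)+2)*(π*h) = n*(π*h) + 2*(π*h) := by ring
  have f3 : h * (θ h L - θ h ε) = h * θ h L - h * θ h ε := by ring
  have f4 : h * (θ h ε - θ h (c0*h)) = h * θ h ε - h * θ h (c0*h) := by ring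
  have f5 : 0 ≤ π * h := by positivity
  rw [f1, f3] at d1 d2
  rw [f4] at c1 c2
  rw [f2] at a4
  have f6 : 0 ≤ (n:ℝ) * (π*h) := by positivity
  clear_value S ε η Q
  constructor <;> linarith

lemma ineq_lim (g g' : ℝ → ℝ) (L : ℝ) (hg : ∀ y ∈ Ioc 0 L, HasDerivAt g (g' y) y)
    (hg' : ∀ y ∈ Ioc 0 L, g' y ≤ 0) (ht : Tendsto g (𝓝[>] 0) (𝓝 0)) :
    ∀ y ∈ Ioc 0 L, g y ≤ 0 := by
  intro y hy
  have hanti : AntitoneOn g (Ioc 0 L) := by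
    apply antitoneOn_of_deriv_nonpos (convex_Ioc 0 L)
    · exact fun z hz => (hg z hz).continuousAt.continuousWithinAt
    · intro z hz
      exact (hg z (interior_subset hz)).differentiableAt.differentiableWithinAt
    · intro z hz
      rw [(hg z (interior_subset hz)).deriv]
      exact hg' z (interior_subset hz)
  apply ge_of_tendsto ht
  have : Ioo 0 y ∈ 𝓝[>] (0:ℝ) := Ioo_mem_nhdsGT hy.1
  filter_upwards [this] with x hx
  exact hanti ⟨hx.1, hx.2.le.trans hy.2⟩ hy hx.2.le

set_option maxHeartbeats 1000000 in
lemma pot_bound (M l a α rmax Xm : ℝ) (hM : 0 < M) (hl : 0 < l) (ha : |a| < l) (hr : 0 < rmax) :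
    ∃ A > 0, ∀ r, rmax ≤ r → 0 ≤ Vsig M l a r → Vsig M l a r ≤ Xm →
      |Vjunk M l a α r + Vmass M l a α r - (2-α)*(r^2/l^4)| ≤ A := by
  have hq : 0 ≤ a^2/l^2 ∧ a^2/l^2 ≤ 1 := by
    constructor
    · positivity
    · rw [div_le_one (by positivity)]
      rw [← sq_abs a]
      exact pow_le_pow_left₀ (abs_nonneg a) ha.le 2
  set J0 := 1 + 2*M/rmax with hJ0
  have hJ0p : 0 < J0 := by positivity
  refine ⟨|2-α|/l^2 * J0 + (|Xm|+1) * (3*J0 + 5 + 6 + 4*M/rmax + 1 + |α|/l^2*a^2) + 1,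
    by positivity, ?_⟩
  intro r hrr hX0 hXm
  have hr0 : 0 < r := hr.trans_le hrr
  set ρ := r^2+a^2 with hρ
  have hρ0 : 0 < ρ := by positivity
  set X := Vsig M l a r with hX
  set q := r^2/ρ with hqd
  set t := r/ρ with htd
  have hq0 : 0 ≤ q := by positivity
  have hq1 : q ≤ 1 := by rw [hqd, div_le_one hρ0]; nlinarith [sq_nonneg a]
  have ht0 : 0 ≤ t := by positivity
  have ht1 : t ≤ 1/rmax := by
    rw [htd, div_le_div_iff₀ hρ0 hr]
    nlinarith [sq_nonneg a]
  have hD : Dm M l a r = X * ρ^2 := by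
    rw [hX, Vsig, ← hρ]; field_simp
  have hXe : X = (1 + r^2/l^2)/ρ - 2*M*r/ρ^2 := by
    rw [hX, Vsig, Dm, ← hρ]; field_simp
  set J := X * r^2 - r^2/l^2 with hJ
  have hJe : J = q*(1 - a^2/l^2) - 2*M*(t*q) := by
    rw [hJ, hXe, hqd, htd]
    have : r^2 = ρ - a^2 := by rw [hρ]; ring
    field_simp
    rw [hρ]; ring
  have htq : t*q ≤ 1/rmax := (mul_le_of_le_one_right ht0 hq1).trans ht1
  have htq0 : 0 ≤ t*q := by positivity
  have hMt : 2*M*(t*q) ≤ 2*M/rmax := by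
    have := mul_le_mul_of_nonneg_left htq (by positivity : 0 ≤ 2*M)
    calc _ ≤ _ := this
      _ = _ := by ring
  have hMt' : 4*M*t ≤ 4*M/rmax := by
    have := mul_le_mul_of_nonneg_left ht1 (by positivity : 0 ≤ 4*M)
    calc _ ≤ _ := this
      _ = _ := by ring
  have hJb : |J| ≤ J0 := by
    rw [hJe, hJ0, abs_le]
    have h1 : 0 ≤ q*(1 - a^2/l^2) := mul_nonneg hq0 (by linarith [hq.2])
    have h2 : q*(1 - a^2/l^2) ≤ 1 :=
      mul_le_one₀ hq1 (by linarith [hq.2]) (by linarith [hq.1])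
    have h3 : 0 ≤ 2*M*(t*q) := by positivity
    have h4 : 0 ≤ 2*M/rmax := by positivity
    constructor <;> linarith
  have hTh : 0 ≤ Th α ∧ Th α ≤ 1 := by
    unfold Th; split_ifs <;> norm_num
  set G := -3*J - 5*(q*(a^2/l^2)) + 3*(q*(1+a^2/l^2)) - 4*M*t + (1-q) - α/l^2*a^2*Th α with hG
  have hmain : Vjunk M l a α r + Vmass M l a α r - (2-α)*(r^2/l^4) = (2-α)/l^2 * J + X * G := by
    rw [Vjunk, Vmass, hD, hG, hJ, hqd, htd, ← hρ]
    have : a^2 = ρ - r^2 := by rw [hρ]; ring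
    rw [this]
    field_simp
    ring
  have hGb : |G| ≤ 3*J0 + 5 + 6 + 4*M/rmax + 1 + |α|/l^2*a^2 := by
    have e1 : |α/l^2*a^2*Th α| ≤ |α|/l^2*a^2 := by
      rw [abs_mul, abs_mul, abs_div, abs_of_nonneg hTh.1, abs_of_nonneg (sq_nonneg a),
        abs_of_nonneg (sq_nonneg l)]
      exact mul_le_of_le_one_right (by positivity) hTh.2
    have e2 : 0 ≤ q*(a^2/l^2) := mul_nonneg hq0 hq.1
    have e3 : q*(a^2/l^2) ≤ 1 := mul_le_one₀ hq1 hq.1 hq.2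
    have e4 : q*(1+a^2/l^2) = q + q*(a^2/l^2) := by ring
    have e5 : 0 ≤ 4*M*t := by positivity
    rw [abs_le] at e1 hJb
    rw [hG, e4, abs_le]
    have e6 : 0 ≤ 4*M/rmax := by positivity
    obtain ⟨e7, e8⟩ := e1
    obtain ⟨e9, e10⟩ := hJb
    clear_value G J J0 X q t ρ
    constructor <;> linarith
  rw [hmain]
  have k1 : |(2-α)/l^2 * J| ≤ |2-α|/l^2 * J0 := by
    rw [abs_mul, abs_div, abs_of_nonneg (sq_nonneg l)]
    exact mul_le_mul_of_nonneg_left hJb (by positivity)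
  have k2 : |X * G| ≤ (|Xm|+1) * (3*J0 + 5 + 6 + 4*M/rmax + 1 + |α|/l^2*a^2) := by
    rw [abs_mul, abs_of_nonneg hX0]
    apply mul_le_mul _ hGb (abs_nonneg _) (by positivity)
    linarith [le_abs_self Xm]
  have k3 := abs_add_le ((2-α)/l^2 * J) (X * G)
  linarith

set_option maxHeartbeats 1000000 in
lemma geom (M l a α : ℝ) (hM : 0 < M) (hl : 0 < l) (ha : |a| < l)
    (rp : ℝ) (hrp : 0 < rp)
    (hrppos : ∀ r, rp < r → 0 < Dm M l a r)
    (rmax : ℝ) (hrmax : rp < rmax)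
    (hmax : ∀ r ∈ Set.Ici rp, r ≠ rmax → Vsig M l a r < Vsig M l a rmax)
    (R : ℝ → ℝ) (hRmono : StrictMonoOn R (Set.Iio (π/2)))
    (hRderiv : ∀ x < π/2, HasDerivAt R (Dm M l a (R x) / ((R x)^2 + a^2)) x)
    (hRtop : Filter.Tendsto R (nhdsWithin (π/2) (Set.Iio (π/2))) Filter.atTop)
    (xmax : ℝ) (hxmax : xmax < π/2) (hRxmax : R xmax = rmax) :
    (∀ y ∈ Ioc 0 (π/2 - xmax), rmax ≤ R (π/2 - y)) ∧
    (∀ y ∈ Ioc 0 (π/2 - xmax), 0 < Vsig M l a (R (π/2 - y)) ∧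
      Vsig M l a (R (π/2 - y)) ≤ Vsig M l a rmax) ∧
    (∃ A > 0, ∀ y ∈ Ioc 0 (π/2 - xmax),
      |Vjunk M l a α (R (π/2 - y)) + Vmass M l a α (R (π/2 - y)) - (2-α)/y^2| ≤ A) ∧
    (∃ c > 0, ∃ C > 0, ∀ y ∈ Ioc 0 (π/2 - xmax), c / y ≤ R (π/2 - y) ∧ R (π/2 - y) ≤ C / y) := by
  set L := π/2 - xmax with hL
  have hL0 : 0 < L := by linarith
  set r : ℝ → ℝ := fun y => R (π/2 - y) with hr
  have hrm0 : 0 < rmax := hrp.trans hrmax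
  have hrge : ∀ y ∈ Ioc 0 L, rmax ≤ r y := by
    intro y hy
    rw [← hRxmax]
    apply hRmono.monotoneOn (mem_Iio.mpr hxmax) (mem_Iio.mpr (by linarith [hy.1]))
    rw [hL] at hy; linarith [hy.2]
  have hrpos : ∀ y ∈ Ioc 0 L, 0 < r y := fun y hy => hrm0.trans_le (hrge y hy)
  have hV : ∀ y ∈ Ioc 0 L, 0 < Vsig M l a (r y) ∧ Vsig M l a (r y) ≤ Vsig M l a rmax := by
    intro y hy
    have h1 := hrge y hy
    have h0 := hrpos y hy
    constructor
    · exact div_pos (hrppos _ (hrmax.trans_le h1)) (by positivity)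
    · by_cases h : r y = rmax
      · rw [h]
      · exact (hmax _ (hrmax.le.trans h1) h).le
  -- the inverse radius
  set w : ℝ → ℝ := fun y => (r y)⁻¹ with hw
  have hwpos : ∀ y ∈ Ioc 0 L, 0 < w y := fun y hy => inv_pos.mpr (hrpos y hy)
  have hwle : ∀ y ∈ Ioc 0 L, w y ≤ 1/rmax := by
    intro y hy
    rw [one_div]
    exact inv_anti₀ hrm0 (hrge y hy)
  have hwt : Tendsto w (𝓝[>] 0) (𝓝 0) := by
    apply Tendsto.comp tendsto_inv_atTop_zero
    apply hRtop.comp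
    apply tendsto_nhdsWithin_of_tendsto_nhds_of_eventually_within
    · have : Tendsto (fun y : ℝ => π/2 - y) (𝓝 0) (𝓝 (π/2 - 0)) := tendsto_const_nhds.sub tendsto_id
      rw [sub_zero] at this
      exact this.mono_left nhdsWithin_le_nhds
    · filter_upwards [self_mem_nhdsWithin] with y hy
      simp only [mem_Ioi] at hy
      simp only [mem_Iio]; linarith
  set F : ℝ → ℝ := fun y => 1/l^2 + (w y)^2 - 2*M*((w y)/((r y)^2+a^2)) with hF
  have hwd : ∀ y ∈ Ioc 0 L, HasDerivAt w (F y) y := by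
    intro y hy
    have h0 := hrpos y hy
    have e1 : HasDerivAt (fun y : ℝ => π/2 - y) (-1) y := by
      simpa using (hasDerivAt_id y).const_sub (π/2)
    have e2 := ((hRderiv (π/2 - y) (by linarith [hy.1])).comp y e1).inv (show R (π/2 - y) ≠ 0 from h0.ne')
    have e3 : HasDerivAt w (-(Dm M l a (r y) / ((r y)^2 + a^2) * -1) / (r y)^2) y := e2
    convert e3 using 1
    simp only [hF, hw, Dm]
    have : 0 < (r y)^2 + a^2 := by positivity
    field_simp
    ring
  set C2 := 1 + 2*M/rmax with hC2
  have hC20 : 0 < C2 := by positivity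
  have hFb : ∀ y ∈ Ioc 0 L, |F y - 1/l^2| ≤ C2 * (w y)^2 := by
    intro y hy
    have h0 := hrpos y hy
    have h1 := hwpos y hy
    have h2 := hwle y hy
    have e1 : (w y)/((r y)^2+a^2) ≤ (w y)^3 := by
      have : (w y)^3 = w y / (r y)^2 := by simp only [hw]; field_simp
      rw [this]
      apply div_le_div_of_nonneg_left h1.le (by positivity)
      nlinarith [sq_nonneg a]
    have e2 : 0 ≤ (w y)/((r y)^2+a^2) := by positivity
    have e3 : (w y)^3 ≤ (w y)^2 * (1/rmax) := by
      rw [pow_succ]; exact mul_le_mul_of_nonneg_left h2 (by positivity)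
    have e4 : 2*M*((w y)/((r y)^2+a^2)) ≤ 2*M*((w y)^2 * (1/rmax)) :=
      mul_le_mul_of_nonneg_left (e1.trans e3) (by positivity)
    have e5 : 0 ≤ 2*M*((w y)/((r y)^2+a^2)) := by positivity
    have e6 : C2 * (w y)^2 = (w y)^2 + 2*M*((w y)^2 * (1/rmax)) := by rw [hC2]; field_simp
    have e7 : F y - 1/l^2 = (w y)^2 - 2*M*((w y)/((r y)^2+a^2)) := by simp only [hF]; ring
    rw [e7, e6, abs_le]
    have e8 : 0 ≤ (w y)^2 := by positivity
    constructor <;> linarith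
  set C1 := 1/l^2 + C2 * (1/rmax)^2 with hC1
  have hC10 : 0 < C1 := by positivity
  have hw1 : ∀ y ∈ Ioc 0 L, w y ≤ C1 * y := by
    intro y hy
    have := ineq_lim (fun y => w y - C1 * y) (fun y => F y - C1) L
      (fun z hz => by
        have := (hwd z hz).sub ((hasDerivAt_id z).const_mul C1)
        rw [mul_one] at this
        exact this)
      (fun z hz => by
        have h1 := (abs_le.mp (hFb z hz)).2
        have h2 : C2 * (w z)^2 ≤ C2 * (1/rmax)^2 :=
          mul_le_mul_of_nonneg_left (pow_le_pow_left₀ (hwpos z hz).le (hwle z hz) 2) hC20.le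
        simp only [hC1]; linarith)
      (by
        have h1 : Tendsto (fun y : ℝ => C1 * y) (𝓝[>] 0) (𝓝 0) := by
          have : Tendsto (fun y : ℝ => C1 * y) (𝓝 0) (𝓝 (C1*0)) := tendsto_id.const_mul C1
          rw [mul_zero] at this
          exact this.mono_left nhdsWithin_le_nhds
        simpa using hwt.sub h1) y hy
    linarith
  set C3 := C2 * C1^2 with hC3
  have hC30 : 0 < C3 := by positivity
  have hFb2 : ∀ y ∈ Ioc 0 L, |F y - 1/l^2| ≤ 3 * C3 * y^2 := by
    intro y hy
    have h1 : (w y)^2 ≤ (C1*y)^2 := pow_le_pow_left₀ (hwpos y hy).le (hw1 y hy) 2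
    have h2 := mul_le_mul_of_nonneg_left h1 hC20.le
    have h3 : C2 * (C1*y)^2 = C3 * y^2 := by rw [hC3]; ring
    have h4 : 0 ≤ C3 * y^2 := by positivity
    linarith [hFb y hy]
  have hcub : ∀ z : ℝ, HasDerivAt (fun y : ℝ => C3 * y^3) (3*C3*z^2) z := by
    intro z
    have h := (hasDerivAt_pow 3 z).const_mul C3
    have e : 3*C3*z^2 = C3 * (((3:ℕ):ℝ) * z^(3-1)) := by norm_num; ring
    rw [e]; exact h
  have hlin : ∀ z : ℝ, HasDerivAt (fun y : ℝ => y/l^2) (1/l^2) z := by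
    intro z; exact (hasDerivAt_id z).div_const (l^2)
  have tcub : Tendsto (fun y : ℝ => C3 * y^3) (𝓝[>] 0) (𝓝 0) := by
    have : Tendsto (fun y : ℝ => C3 * y^3) (𝓝 0) (𝓝 (C3 * 0^3)) := (hcub 0).continuousAt
    simp only [ne_eq, OfNat.ofNat_ne_zero, not_false_eq_true, zero_pow, mul_zero] at this
    exact this.mono_left nhdsWithin_le_nhds
  have tlin : Tendsto (fun y : ℝ => y/l^2) (𝓝[>] 0) (𝓝 0) := by
    have : Tendsto (fun y : ℝ => y/l^2) (𝓝 0) (𝓝 (0/l^2)) := (hlin 0).continuousAt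
    rw [zero_div] at this
    exact this.mono_left nhdsWithin_le_nhds
  have hw2 : ∀ y ∈ Ioc 0 L, |w y - y/l^2| ≤ C3 * y^3 := by
    intro y hy
    have k1 := ineq_lim (fun y => w y - y/l^2 - C3*y^3) (fun y => F y - 1/l^2 - 3*C3*y^2) L
      (fun z hz => ((hwd z hz).sub (hlin z)).sub (hcub z))
      (fun z hz => by linarith [(abs_le.mp (hFb2 z hz)).2])
      (by simpa using (hwt.sub tlin).sub tcub) y hy
    have k2 := ineq_lim (fun y => y/l^2 - w y - C3*y^3) (fun y => 1/l^2 - F y - 3*C3*y^2) L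
      (fun z hz => ((hlin z).sub (hwd z hz)).sub (hcub z))
      (fun z hz => by linarith [(abs_le.mp (hFb2 z hz)).1])
      (by simpa using (tlin.sub hwt).sub tcub) y hy
    rw [abs_le]; constructor <;> linarith
  -- lower bound
  have hlow : ∃ c > 0, ∀ y ∈ Ioc 0 L, c * y ≤ w y := by
    obtain ⟨y1, hy1, hy1L, hy1C⟩ : ∃ y1 > 0, y1 ≤ L ∧ C3 * y1^2 ≤ 1/(2*l^2) := by
      refine ⟨min L (√(1/(2*l^2*C3))), by positivity, min_le_left _ _, ?_⟩
      have : (min L (√(1/(2*l^2*C3))))^2 ≤ (√(1/(2*l^2*C3)))^2 :=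
        pow_le_pow_left₀ (by positivity) (min_le_right _ _) 2
      rw [Real.sq_sqrt (by positivity)] at this
      calc _ ≤ C3 * (1/(2*l^2*C3)) := mul_le_mul_of_nonneg_left this hC30.le
        _ = _ := by field_simp
    have hsmall : ∀ y, 0 < y → y ≤ y1 → y * (1/(2*l^2)) ≤ w y := by
      intro y h0 h1
      have h2 := (abs_le.mp (hw2 y ⟨h0, h1.trans hy1L⟩)).1
      have h3 : y^2 ≤ y1^2 := pow_le_pow_left₀ h0.le h1 2
      have h4 : C3 * y^2 ≤ 1/(2*l^2) := (mul_le_mul_of_nonneg_left h3 hC30.le).trans hy1C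
      have h5 : y * (C3 * y^2) ≤ y * (1/(2*l^2)) := mul_le_mul_of_nonneg_left h4 h0.le
      have h6 : y/l^2 = 2 * (y * (1/(2*l^2))) := by field_simp
      have h7 : C3 * y^3 = y * (C3 * y^2) := by ring
      rw [h6, h7] at h2
      linarith
    refine ⟨(y1/L) * (1/(2*l^2)), by positivity, ?_⟩
    intro y hy
    rcases le_total y y1 with h | h
    · have h1 := hsmall y hy.1 h
      have h2 : y1/L ≤ 1 := by rw [div_le_one hL0]; exact hy1L
      have h3 : (y1/L) * (y * (1/(2*l^2))) ≤ y * (1/(2*l^2)) :=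
        mul_le_of_le_one_left (by have := hy.1; positivity) h2
      calc _ = (y1/L) * (y * (1/(2*l^2))) := by ring
        _ ≤ _ := h3
        _ ≤ _ := h1
    · have h1 := hsmall y1 hy1 le_rfl
      have h2 : w y1 ≤ w y := by
        apply inv_anti₀ (hrpos y hy)
        apply hRmono.monotoneOn (mem_Iio.mpr (by linarith [hy.1])) (mem_Iio.mpr (by linarith))
        linarith
      have h3 : y/L ≤ 1 := by rw [div_le_one hL0]; exact hy.2
      have h4 : (y/L) * (y1 * (1/(2*l^2))) ≤ y1 * (1/(2*l^2)) :=
        mul_le_of_le_one_left (by positivity) h3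
      calc _ = (y/L) * (y1 * (1/(2*l^2))) := by ring
        _ ≤ _ := h4
        _ ≤ _ := h1.trans h2
  obtain ⟨c, hc, hcw⟩ := hlow
  have hrw : ∀ y, r y = (w y)⁻¹ := by intro y; simp [hw]
  refine ⟨hrge, hV, ?_, ?_⟩
  · obtain ⟨A, hA, hAb⟩ := pot_bound M l a α rmax (Vsig M l a rmax) hM hl ha hrm0
    refine ⟨A + |2-α| * ((l^2*C3) * (1+l^2*C1) / (c^2*l^4)), by positivity, ?_⟩
    intro y hy
    have h1 := hAb (r y) (hrge y hy) (hV y hy).1.le (hV y hy).2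
    have hy0 := hy.1
    have hwp := hwpos y hy
    have h2 : |(r y)^2/l^4 - 1/y^2| ≤ (l^2*C3) * (1+l^2*C1) / (c^2*l^4) := by
      have e1 : (r y)^2/l^4 - 1/y^2 = ((y - l^2 * w y) * (y + l^2 * w y)) / ((w y)^2*y^2*l^4) := by
        rw [hrw]; field_simp; ring
      have e2 : |y - l^2 * w y| ≤ l^2*C3*y^3 := by
        have : y - l^2 * w y = -(l^2 * (w y - y/l^2)) := by field_simp; ring
        rw [this, abs_neg, abs_mul, abs_of_pos (by positivity : 0 < l^2), mul_assoc]
        exact mul_le_mul_of_nonneg_left (hw2 y hy) (by positivity)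
      have e3 : |y + l^2 * w y| ≤ (1+l^2*C1)*y := by
        rw [abs_of_pos (by positivity)]
        have := mul_le_mul_of_nonneg_left (hw1 y hy) (by positivity : 0 ≤ l^2)
        linarith
      rw [e1, abs_div, abs_mul, abs_of_pos (by positivity : 0 < (w y)^2*y^2*l^4)]
      have e4 : (c*y)^2 ≤ (w y)^2 := pow_le_pow_left₀ (by positivity) (hcw y hy) 2
      calc _ ≤ (l^2*C3*y^3) * ((1+l^2*C1)*y) / ((c*y)^2*y^2*l^4) := by
            apply div_le_div₀ (by positivity) (mul_le_mul e2 e3 (abs_nonneg _) (by positivity))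
              (by positivity)
            gcongr
        _ = _ := by field_simp
    have h3 : Vjunk M l a α (r y) + Vmass M l a α (r y) - (2-α)/y^2 =
      (Vjunk M l a α (r y) + Vmass M l a α (r y) - (2-α)*((r y)^2/l^4)) +
        (2-α) * ((r y)^2/l^4 - 1/y^2) := by ring
    have h4 : |(2-α) * ((r y)^2/l^4 - 1/y^2)| ≤ |2-α| * ((l^2*C3) * (1+l^2*C1) / (c^2*l^4)) := by
      rw [abs_mul]; exact mul_le_mul_of_nonneg_left h2 (abs_nonneg _)
    have h5 := abs_add_le (Vjunk M l a α (r y) + Vmass M l a α (r y) - (2-α)*((r y)^2/l^4))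
      ((2-α) * ((r y)^2/l^4 - 1/y^2))
    rw [← h3] at h5
    exact h5.trans (add_le_add h1 h4)
  · refine ⟨1/C1, by positivity, 1/c, by positivity, ?_⟩
    intro y hy
    have hy0 := hy.1
    have hwp := hwpos y hy
    change 1/C1/y ≤ r y ∧ r y ≤ 1/c/y
    rw [hrw, div_div, div_div, ← one_div]
    exact ⟨one_div_le_one_div_of_le hwp (hw1 y hy), one_div_le_one_div_of_le (by positivity) (hcw y hy)⟩

lemma const_Ioo (f : ℝ → ℝ) (a b : ℝ) (hf : ∀ x ∈ Ioo a b, HasDerivAt f 0 x) :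
    ∀ x ∈ Ioo a b, ∀ y ∈ Ioo a b, f x = f y := by
  intro x hx y hy
  exact isOpen_Ioo.is_const_of_deriv_eq_zero isPreconnected_Ioo
    (fun z hz => (hf z hz).differentiableAt.differentiableWithinAt)
    (fun z hz => (hf z hz).deriv) hx hy

lemma eig_mp (M l a α : ℝ) (R : ℝ → ℝ) (xmax h κ : ℝ) (hx : xmax < π/2) (hh : 0 < h)
    (s : ℝ) (hs : 1/2 < s) (f df q : ℝ → ℝ)
    (hf1 : ∀ y > 0, HasDerivAt f (df y) y) (hf2 : ∀ y > 0, HasDerivAt df (q y * f y) y)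
    (hqe : ∀ y ∈ Ioc 0 (π/2 - xmax), Vfull M l a α R h (π/2 - y) - κ = h^2 * q y)
    (Cb : ℝ) (hCb0 : 0 < Cb)
    (hCb : ∀ y ∈ Ioc 0 (π/2 - xmax), |f y| ≤ Cb * y^s ∧ |df y| ≤ Cb * y^(s-1))
    (hnd : ∀ y ∈ Ioc 0 (π/2 - xmax), 0 < f y^2 + df y^2)
    (c : ℝ) (hc : 0 < c) (hRc : ∀ y ∈ Ioc 0 (π/2 - xmax), c / y ≤ R (π/2 - y))
    (H : IsDirichletEigenvalue M l a α R xmax h κ) : f (π/2 - xmax) = 0 := by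
  obtain ⟨u, ⟨x0, hx0, hux0⟩, hu2, hode, hu0, hItg⟩ := H
  set L := π/2 - xmax with hL
  have hL0 : 0 < L := by linarith
  set g : ℝ → ℝ := fun x => f (π/2 - x) with hg
  set dg : ℝ → ℝ := fun x => -df (π/2 - x) with hdg
  have hsub : ∀ x : ℝ, HasDerivAt (fun x : ℝ => π/2 - x) (-1) x := fun x => by
    simpa using (hasDerivAt_id x).const_sub (π/2)
  have hg1 : ∀ x < π/2, HasDerivAt g (dg x) x := by
    intro x hx
    have := (hf1 (π/2 - x) (by linarith)).comp x (hsub x)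
    rw [mul_neg_one] at this
    exact this
  have hg2 : ∀ x < π/2, HasDerivAt dg (q (π/2 - x) * g x) x := by
    intro x hx
    have := ((hf2 (π/2 - x) (by linarith)).comp x (hsub x)).neg
    rw [mul_neg_one, neg_neg] at this
    exact this
  have hmem : ∀ x ∈ Ioo xmax (π/2), π/2 - x ∈ Ioc 0 L := fun x hx =>
    ⟨by linarith [hx.2], by rw [hL]; linarith [hx.1]⟩
  have hu2' : ContDiffOn ℝ (1+1) u (Ioo xmax (π/2)) := hu2.mono Ioo_subset_Ico_self
  have hu3 := (contDiffOn_succ_iff_deriv_of_isOpen isOpen_Ioo).mp hu2'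
  have hud : ∀ x ∈ Ioo xmax (π/2), HasDerivAt u (deriv u x) x := fun x hx =>
    ((hu3.1 x hx).differentiableAt (isOpen_Ioo.mem_nhds hx)).hasDerivAt
  have hudd : ∀ x ∈ Ioo xmax (π/2), HasDerivAt (deriv u) (q (π/2 - x) * u x) x := by
    intro x hx
    have h1 : DifferentiableAt ℝ (deriv u) x :=
      ((hu3.2.2.differentiableOn one_ne_zero) x hx).differentiableAt (isOpen_Ioo.mem_nhds hx)
    have h2 := hode x hx
    have h3 := hqe _ (hmem x hx)
    rw [sub_sub_cancel] at h3
    have h4 : deriv (deriv u) x = q (π/2 - x) * u x := by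
      have : h^2 * deriv (deriv u) x = h^2 * (q (π/2 - x) * u x) := by
        rw [← mul_assoc, ← h3]; linarith
      exact mul_left_cancel₀ (by positivity) this
    rw [← h4]; exact h1.hasDerivAt
  -- Wronskian
  set W : ℝ → ℝ := fun x => u x * dg x - deriv u x * g x with hW
  have hWc := const_Ioo W xmax (π/2) (fun x hx => by
    have := ((hud x hx).mul (hg2 x hx.2)).sub ((hudd x hx).mul (hg1 x hx.2))
    exact this.congr_deriv (by ring))
  have hdn : ∀ x ∈ Ioo xmax (π/2), 0 < g x^2 + dg x^2 := by
    intro x hx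
    have := hnd _ (hmem x hx)
    simp only [hg, hdg, neg_sq]; exact this
  have hW0 : ∀ x ∈ Ioo xmax (π/2), W x = 0 := by
    by_contra hcon
    push Not at hcon
    obtain ⟨z, hz, hWz⟩ := hcon
    set K := 2*Cb^2*(1+1/c^2) / (W z)^2 with hK
    have hWz2 : 0 < (W z)^2 := by positivity
    have hb : ∀ x ∈ Ioo xmax (π/2), (π/2 - x)^(-(2*s)) ≤
        K * ((deriv u x)^2 + (R x)^2 * (u x)^2) := by
      intro x hx
      have hy := hmem x hx
      set y := π/2 - x with hyd
      have hy0 := hy.1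
      have hxy : x = π/2 - y := by rw [hyd]; ring
      have e0 : W z = u x * dg x - deriv u x * g x := hWc z hz x hx
      have e1 : (W z)^2 ≤ 2*((u x)^2 * (dg x)^2 + (deriv u x)^2 * (g x)^2) := by
        rw [e0]; nlinarith [sq_nonneg (u x * dg x + deriv u x * g x)]
      have e2 : (g x)^2 ≤ Cb^2 * y^(2*s) := by
        have h1 : (g x)^2 ≤ (Cb * y^s)^2 := sq_le_sq' (by linarith [(abs_le.mp (hCb y hy).1).1]) (abs_le.mp (hCb y hy).1).2
        rw [mul_pow, ← rpow_natCast (y^s), ← rpow_mul hy0.le] at h1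
        rw [mul_comm 2 s]; exact_mod_cast h1
      have e3 : (dg x)^2 ≤ Cb^2 * y^(2*s) / y^2 := by
        have h1 : (df y)^2 ≤ (Cb * y^(s-1))^2 := sq_le_sq' (by linarith [(abs_le.mp (hCb y hy).2).1]) (abs_le.mp (hCb y hy).2).2
        have h2 : (y^(s-1))^2 = y^(2*s)/y^2 := by
          rw [rpow_sub_one hy0.ne', div_pow, ← rpow_natCast (y^s), ← rpow_mul hy0.le, mul_comm 2 s]
          norm_num
        rw [mul_pow, h2] at h1
        simp only [hdg, neg_sq]
        rw [mul_div_assoc]; exact h1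
      have e4 : 1 / y^2 ≤ (R x)^2 / c^2 := by
        have h1 := hRc y hy
        rw [← hxy] at h1
        have h2 : (c/y)^2 ≤ (R x)^2 := pow_le_pow_left₀ (by positivity) h1 2
        rw [le_div_iff₀ (by positivity)]
        calc _ = (c/y)^2 := by rw [div_pow]; ring
          _ ≤ _ := h2
      have hp : 0 < y^(2*s) := rpow_pos_of_pos hy0 _
      have e5 : (u x)^2 * (dg x)^2 ≤ (u x)^2 * (Cb^2 * y^(2*s) * ((R x)^2/c^2)) := by
        apply mul_le_mul_of_nonneg_left _ (sq_nonneg _)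
        refine e3.trans ?_
        rw [div_eq_mul_one_div]
        exact mul_le_mul_of_nonneg_left e4 (by positivity)
      have e6 : (deriv u x)^2 * (g x)^2 ≤ (deriv u x)^2 * (Cb^2 * y^(2*s)) :=
        mul_le_mul_of_nonneg_left e2 (sq_nonneg _)
      have e7 : (W z)^2 ≤ (2*Cb^2*(1+1/c^2) * ((deriv u x)^2 + (R x)^2 * (u x)^2)) * y^(2*s) := by
        have h1 : (2*Cb^2*(1+1/c^2) * ((deriv u x)^2 + (R x)^2 * (u x)^2)) * y^(2*s) =
          2*((u x)^2 * (Cb^2 * y^(2*s) * ((R x)^2/c^2)) + (deriv u x)^2 * (Cb^2 * y^(2*s))) +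
          2*Cb^2*y^(2*s)*((deriv u x)^2/c^2 + (R x)^2 * (u x)^2) := by ring
        have h2 : 0 ≤ 2*Cb^2*y^(2*s)*((deriv u x)^2/c^2 + (R x)^2 * (u x)^2) := by positivity
        rw [h1]; linarith
      rw [rpow_neg hy0.le, ← one_div, div_le_iff₀ hp, hK]
      have h3 : 2*Cb^2*(1+1/c^2) / (W z)^2 * ((deriv u x)^2 + (R x)^2 * (u x)^2) * y^(2*s) =
        ((2*Cb^2*(1+1/c^2) * ((deriv u x)^2 + (R x)^2 * (u x)^2)) * y^(2*s)) / (W z)^2 := by ring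
      rw [h3, le_div_iff₀ hWz2, one_mul]
      exact e7
    have hi : IntegrableOn (fun x : ℝ => (π/2 - x)^(-(2*s))) (Ioo xmax (π/2)) := by
      refine Integrable.mono' (hItg.const_mul K) ?_ ?_
      · apply ContinuousOn.aestronglyMeasurable _ measurableSet_Ioo
        apply ContinuousOn.rpow_const (by fun_prop)
        intro x hx
        left; linarith [hx.2]
      · rw [ae_restrict_iff' measurableSet_Ioo]
        filter_upwards with x hx
        rw [Real.norm_of_nonneg (rpow_nonneg (by linarith [hx.2]) _)]
        exact hb x hx
    rw [← intervalIntegrable_iff_integrableOn_Ioo_of_le hx.le] at hi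
    have hi2 := hi.comp_sub_left (π/2)
    simp only [sub_sub_cancel, sub_self] at hi2
    have hi3 := hi2.symm
    rw [intervalIntegrable_iff_integrableOn_Ioo_of_le hL0.le,
      intervalIntegral.integrableOn_Ioo_rpow_iff hL0] at hi3
    linarith
  have hWe : ∀ x ∈ Ioo xmax (π/2), u x * dg x = deriv u x * g x := fun x hx => by
    have := hW0 x hx
    simp only [hW] at this; linarith
  set C : ℝ → ℝ := fun x => (u x * g x + deriv u x * dg x) / (g x^2 + dg x^2) with hC
  have hCg : ∀ x ∈ Ioo xmax (π/2), u x = C x * g x := by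
    intro x hx
    have h1 := hdn x hx
    have h2 := hWe x hx
    simp only [hC]
    rw [div_mul_eq_mul_div, eq_div_iff h1.ne']
    linear_combination dg x * h2
  have hCc := const_Ioo C xmax (π/2) (fun x hx => by
    have h1 := hdn x hx
    have h2 := hWe x hx
    have h3 := (((hud x hx).mul (hg1 x hx.2)).add ((hudd x hx).mul (hg2 x hx.2))).div
      (((hg1 x hx.2).pow 2).add ((hg2 x hx.2).pow 2)) h1.ne'
    refine h3.congr_deriv ?_
    rw [div_eq_zero_iff]
    left
    simp only [Pi.add_apply, Pi.mul_apply, Pi.pow_apply]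
    norm_num
    linear_combination (-(1 + q (π/2 - x)) * (g x ^ 2 - dg x ^ 2)) * h2)
  have hx0' : x0 ∈ Ioo xmax (π/2) := by
    refine ⟨lt_of_le_of_ne hx0.1 ?_, hx0.2⟩
    rintro rfl; exact hux0 hu0
  have hc0 : C x0 ≠ 0 := by
    intro h0
    apply hux0
    rw [hCg x0 hx0', h0, zero_mul]
  have t1 : Tendsto u (𝓝[>] xmax) (𝓝 (u xmax)) := by
    have h1 : ContinuousWithinAt u (Ico xmax (π/2)) xmax := hu2.continuousOn xmax ⟨le_rfl, hx⟩
    have h2 : ContinuousWithinAt u (Ioo xmax (π/2)) xmax := h1.mono Ioo_subset_Ico_self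
    rw [ContinuousWithinAt, nhdsWithin_Ioo_eq_nhdsGT hx] at h2
    exact h2
  have t2 : Tendsto (fun x => C x0 * g x) (𝓝[>] xmax) (𝓝 (C x0 * g xmax)) :=
    ((hg1 xmax hx).continuousAt.tendsto.const_mul _).mono_left nhdsWithin_le_nhds
  have t3 : u =ᶠ[𝓝[>] xmax] (fun x => C x0 * g x) := by
    filter_upwards [Ioo_mem_nhdsGT hx] with x hx'
    rw [hCg x hx', hCc x hx' x0 hx0']
  have t4 := tendsto_nhds_unique (t2.congr' t3.symm) t1
  rw [hu0] at t4
  exact (mul_eq_zero.mp t4).resolve_left hc0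

lemma eig_mpr (M l a α : ℝ) (R : ℝ → ℝ) (xmax h κ : ℝ) (hx : xmax < π/2)
    (hRcont : ContinuousOn R (Iio (π/2)))
    (s : ℝ) (hs : 1/2 < s) (f df q : ℝ → ℝ)
    (hf1 : ∀ y > 0, HasDerivAt f (df y) y) (hf2 : ∀ y > 0, HasDerivAt df (q y * f y) y)
    (hq : ContinuousOn q (Ioi 0))
    (hqe : ∀ y ∈ Ioc 0 (π/2 - xmax), Vfull M l a α R h (π/2 - y) - κ = h^2 * q y)
    (Cb : ℝ) (hCb0 : 0 < Cb)
    (hCb : ∀ y ∈ Ioc 0 (π/2 - xmax), |f y| ≤ Cb * y^s ∧ |df y| ≤ Cb * y^(s-1))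
    (y0 : ℝ) (hy0 : 0 < y0) (hy0L : y0 ≤ π/2 - xmax) (hpos : 0 < f y0)
    (C : ℝ) (hC : 0 < C)
    (hRc : ∀ y ∈ Ioc 0 (π/2 - xmax), 0 ≤ R (π/2 - y) ∧ R (π/2 - y) ≤ C / y)
    (H : f (π/2 - xmax) = 0) : IsDirichletEigenvalue M l a α R xmax h κ := by
  set L := π/2 - xmax with hL
  have hL0 : 0 < L := by linarith
  set g : ℝ → ℝ := fun x => f (π/2 - x) with hg
  set dg : ℝ → ℝ := fun x => -df (π/2 - x) with hdg
  have hsub : ∀ x : ℝ, HasDerivAt (fun x : ℝ => π/2 - x) (-1) x := fun x => by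
    simpa using (hasDerivAt_id x).const_sub (π/2)
  have hg1 : ∀ x < π/2, HasDerivAt g (dg x) x := by
    intro x hx
    have := (hf1 (π/2 - x) (by linarith)).comp x (hsub x)
    rw [mul_neg_one] at this
    exact this
  have hg2 : ∀ x < π/2, HasDerivAt dg (q (π/2 - x) * g x) x := by
    intro x hx
    have := ((hf2 (π/2 - x) (by linarith)).comp x (hsub x)).neg
    rw [mul_neg_one, neg_neg] at this
    exact this
  have hmem : ∀ x ∈ Ioo xmax (π/2), π/2 - x ∈ Ioc 0 L := fun x hx =>
    ⟨by linarith [hx.2], by rw [hL]; linarith [hx.1]⟩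
  have hev : ∀ x < π/2, deriv g =ᶠ[𝓝 x] dg := by
    intro x hx
    filter_upwards [Iio_mem_nhds hx] with z hz using (hg1 z hz).deriv
  have hdd : ∀ x < π/2, HasDerivAt (deriv g) (q (π/2 - x) * g x) x := fun x hx =>
    (hg2 x hx).congr_of_eventuallyEq (hev x hx)
  refine ⟨g, ⟨π/2 - y0, ⟨by linarith, by linarith⟩, ?_⟩, ?_, ?_, H, ?_⟩
  · simp only [hg, sub_sub_cancel]; exact hpos.ne'
  · have h1 : ContDiffOn ℝ (1+1) g (Iio (π/2)) := by
      rw [contDiffOn_succ_iff_deriv_of_isOpen isOpen_Iio]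
      refine ⟨fun x hx => (hg1 x hx).differentiableAt.differentiableWithinAt, by simp, ?_⟩
      have h2 : ContDiffOn ℝ (0+1) (deriv g) (Iio (π/2)) := by
        rw [contDiffOn_succ_iff_deriv_of_isOpen isOpen_Iio]
        refine ⟨fun x hx => (hdd x hx).differentiableAt.differentiableWithinAt, by simp, ?_⟩
        rw [contDiffOn_zero]
        have h3 : ContinuousOn (fun x => q (π/2 - x) * g x) (Iio (π/2)) := by
          apply ContinuousOn.mul
          · apply hq.comp (by fun_prop)
            intro x hx
            simp only [mem_Iio] at hx
            simp only [mem_Ioi]; linarith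
          · exact fun x hx => (hg1 x hx).continuousAt.continuousWithinAt
        exact h3.congr (fun x hx => (hdd x hx).deriv)
      rwa [zero_add] at h2
    exact h1.mono (fun x hx => hx.2)
  · intro x hx
    rw [(hdd x hx.2).deriv]
    have h3 := hqe _ (hmem x hx)
    rw [sub_sub_cancel] at h3
    linear_combination g x * h3
  · have hi0 : IntervalIntegrable (fun y : ℝ => y^(2*s-2)) volume 0 L :=
      intervalIntegral.intervalIntegrable_rpow' (by linarith)
    have hi1 := (hi0.comp_sub_left (π/2)).symm
    have e1 : π/2 - L = xmax := by rw [hL]; ring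
    rw [e1, sub_zero, intervalIntegrable_iff_integrableOn_Ioo_of_le hx.le] at hi1
    refine Integrable.mono' (hi1.const_mul (Cb^2*(1+C^2))) ?_ ?_
    · apply ContinuousOn.aestronglyMeasurable _ measurableSet_Ioo
      have k1 : ContinuousOn (deriv g) (Ioo xmax (π/2)) := fun x hx =>
        (hdd x hx.2).continuousAt.continuousWithinAt
      have k2 : ContinuousOn g (Ioo xmax (π/2)) := fun x hx =>
        (hg1 x hx.2).continuousAt.continuousWithinAt
      have k3 : ContinuousOn R (Ioo xmax (π/2)) := hRcont.mono (fun x hx => hx.2)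
      exact (k1.pow 2).add ((k3.pow 2).mul (k2.pow 2))
    · rw [ae_restrict_iff' measurableSet_Ioo]
      filter_upwards with x hx'
      have hy := hmem x hx'
      rw [(hg1 x hx'.2).deriv, Real.norm_of_nonneg (by positivity)]
      have hRR := hRc _ hy
      rw [sub_sub_cancel] at hRR
      simp only [hdg, hg, neg_sq]
      set y := π/2 - x with hyd
      have hy1 := hy.1
      have e2 : (y^(s-1))^2 = y^(2*s-2) := by
        rw [← rpow_natCast (y^(s-1)), ← rpow_mul hy1.le]
        congr 1; push_cast; ring
      have e3 : (y^s)^2 = y^(2*s-2) * y^2 := by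
        rw [← e2, rpow_sub_one hy1.ne']; field_simp
      have h1 : (df y)^2 ≤ (Cb * y^(s-1))^2 := sq_le_sq' (by linarith [(abs_le.mp (hCb y hy).2).1]) (abs_le.mp (hCb y hy).2).2
      have h2 : (f y)^2 ≤ (Cb * y^s)^2 := sq_le_sq' (by linarith [(abs_le.mp (hCb y hy).1).1]) (abs_le.mp (hCb y hy).1).2
      have h3 : (R x)^2 ≤ (C/y)^2 := pow_le_pow_left₀ hRR.1 hRR.2 2
      have h4 : (R x)^2 * (f y)^2 ≤ (C/y)^2 * (Cb * y^s)^2 :=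
        mul_le_mul h3 h2 (sq_nonneg _) (sq_nonneg _)
      have e4 : (C/y)^2 * (Cb * y^s)^2 = Cb^2 * C^2 * y^(2*s-2) := by
        rw [mul_pow, e3]; field_simp
      rw [mul_pow, e2] at h1
      rw [e4] at h4
      calc _ ≤ Cb^2 * y^(2*s-2) + Cb^2 * C^2 * y^(2*s-2) := add_le_add h1 h4
        _ = _ := by ring

set_option maxHeartbeats 1000000 in
lemma per_h (M l a α : ℝ) (hα : α < 9/4) (R : ℝ → ℝ) (xmax h : ℝ) (hx : xmax < π/2) (hh : 0 < h)
    (hh1 : h ≤ 1) (hRcont : ContinuousOn R (Iio (π/2)))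
    (κ1 κ2 Vm A0 c0 c C : ℝ) (hκ1 : 0 < κ1) (hκ : κ1 ≤ κ2) (hκ2 : κ2 ≤ Vm) (hA0 : 0 < A0)
    (hc : 0 < c) (hC : 0 < C)
    (hR : ∀ y ∈ Ioc 0 (π/2 - xmax), c / y ≤ R (π/2 - y) ∧ R (π/2 - y) ≤ C / y)
    (hV : ∀ y ∈ Ioc 0 (π/2 - xmax), 0 < Vsig M l a (R (π/2 - y)) ∧
      Vsig M l a (R (π/2 - y)) ≤ Vm)
    (hA : ∀ y ∈ Ioc 0 (π/2 - xmax),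
      |Vjunk M l a α (R (π/2 - y)) + Vmass M l a α (R (π/2 - y)) - (2-α)/y^2| ≤ A0)
    (hVc : ContinuousOn (fun y => Vsig M l a (R (π/2 - y))) (Ioc 0 (π/2 - xmax)))
    (hBc : ContinuousOn (fun y => Vjunk M l a α (R (π/2 - y)) + Vmass M l a α (R (π/2 - y)))
      (Ioc 0 (π/2 - xmax)))
    (hc0 : c0 = 1/(2*√(A0+Vm))) (hc0L : c0 * h ≤ π/2 - xmax) :
    ∃ θ : ℝ → ℝ → ℝ,
      (∀ κ ∈ Icc κ1 κ2, ∀ y ∈ Icc (c0*h) (π/2 - xmax), HasDerivAt (fun y => θ y κ)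
        ((cos (θ y κ)^2 + (κ - Vfull M l a α R h (π/2 - y)) * sin (θ y κ)^2)/h) y) ∧
      (∀ κ ∈ Icc κ1 κ2, θ (c0*h) κ ∈ Ioo 0 π) ∧
      (∀ κ ∈ Icc κ1 κ2, IsDirichletEigenvalue M l a α R xmax h κ ↔ sin (θ (π/2 - xmax) κ) = 0) ∧
      ContinuousOn (θ (π/2 - xmax)) (Icc κ1 κ2) ∧ StrictMonoOn (θ (π/2 - xmax)) (Icc κ1 κ2) := by
  set L := π/2 - xmax with hL
  have hL0 : 0 < L := by linarith
  set s := 1/2 + √(9/4 - α) with hs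
  have hs2 : 1/2 < s := by
    have : 0 < √(9/4-α) := Real.sqrt_pos.mpr (by linarith)
    linarith
  have hss : s*(s-1) = 2-α := by
    have h1 := Real.sq_sqrt (show 0 ≤ 9/4 - α by linarith)
    rw [hs]; linear_combination h1
  have hVm : 0 < Vm := by linarith
  have hk0 : 0 < √(A0+Vm) := Real.sqrt_pos.mpr (by linarith)
  have hc00 : 0 < c0 := by rw [hc0]; positivity
  have hh2 : 0 < h^2 := by positivity
  have hhsq : h^2 ≤ 1 := pow_le_one₀ hh.le hh1
  set B : ℝ → ℝ := fun y => (Vjunk M l a α (R (π/2 - y)) + Vmass M l a α (R (π/2 - y))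
    - (2-α)/y^2) + Vsig M l a (R (π/2 - y))/h^2 with hB
  have hBcont : ContinuousOn B (Ioc 0 L) := by
    apply ContinuousOn.add
    · apply hBc.sub
      apply ContinuousOn.div continuousOn_const (by fun_prop)
      intro y hy
      have := hy.1
      positivity
    · exact hVc.div_const _
  have hBb : ∀ y ∈ Ioc 0 L, |B y| ≤ A0 + Vm/h^2 := by
    intro y hy
    refine (abs_add_le _ _).trans (add_le_add (hA y hy) ?_)
    rw [abs_of_pos (div_pos (hV y hy).1 hh2)]
    exact div_le_div_of_nonneg_right (hV y hy).2 hh2.le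
  have hlam : κ1/h^2 ≤ κ2/h^2 := div_le_div_of_nonneg_right hκ hh2.le
  obtain ⟨ψ, dψ, p, hψ, hdψ, hp, hd1, hd2, hpf, ⟨Cb, hCb0, hCb⟩, hposk⟩ :=
    recessive s L (κ1/h^2) (κ2/h^2) (A0 + Vm/h^2) hs2 hL0 hlam B hBcont hBb
  have hBl : ∀ y ∈ Ioc 0 L, ∀ lam ∈ Icc (κ1/h^2) (κ2/h^2), |B y - lam| ≤ (√(A0+Vm)/h)^2 := by
    intro y hy lam hlam
    rw [div_pow, Real.sq_sqrt (by linarith), add_div]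
    have e1 : B y - lam = (Vjunk M l a α (R (π/2 - y)) + Vmass M l a α (R (π/2 - y))
      - (2-α)/y^2) + (Vsig M l a (R (π/2 - y))/h^2 - lam) := by simp only [hB]; ring
    rw [e1]
    refine (abs_add_le _ _).trans (add_le_add ((hA y hy).trans ?_) ?_)
    · rw [le_div_iff₀ hh2]; nlinarith
    · have e2 : Vsig M l a (R (π/2 - y))/h^2 ≤ Vm/h^2 :=
        div_le_div_of_nonneg_right (hV y hy).2 hh2.le
      have e3 : 0 < Vsig M l a (R (π/2 - y))/h^2 := div_pos (hV y hy).1 hh2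
      have e4 : 0 < κ1/h^2 := by positivity
      have e5 : κ2/h^2 ≤ Vm/h^2 := div_le_div_of_nonneg_right hκ2 hh2.le
      rw [abs_le]
      constructor <;> linarith [hlam.1, hlam.2]
  have hpos : ∀ lam ∈ Icc (κ1/h^2) (κ2/h^2), ∀ y, 0 < y → y ≤ c0*h → 0 < ψ (y, lam) := by
    intro lam hlam y hy hyc
    apply hposk (√(A0+Vm)/h) (by positivity) hBl y hy (hyc.trans hc0L) _ lam hlam
    calc _ ≤ c0*h*(√(A0+Vm)/h) := mul_le_mul_of_nonneg_right hyc (by positivity)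
      _ = 1/2 := by rw [hc0]; field_simp
  have hy0 : 0 < c0*h := by positivity
  have hlm : ∀ κ ∈ Icc κ1 κ2, κ/h^2 ∈ Icc (κ1/h^2) (κ2/h^2) := fun κ hκ =>
    ⟨div_le_div_of_nonneg_right hκ.1 hh2.le, div_le_div_of_nonneg_right hκ.2 hh2.le⟩
  have hpV : ∀ κ ∈ Icc κ1 κ2, ∀ y ∈ Ioc 0 L, Vfull M l a α R h (π/2 - y) - κ = h^2 * p (y, κ/h^2) := by
    intro κ hκ y hy
    rw [hpf y hy _ (hlm κ hκ), hss, Vfull]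
    simp only [hB]
    have := hy.1
    field_simp
    ring
  have hpr := prufer s L (κ1/h^2) (κ2/h^2) hs2 hlam B ψ dψ p hψ hdψ hp hd1 hd2 hpf Cb hCb
    (c0*h) hy0 hc0L (fun y h1 h2 lam h3 => hpos lam h3 y h1 h2) h hh
  obtain ⟨θ, t1, t2, t3, t4, t5⟩ := hpr
  refine ⟨fun y κ => θ y (κ/h^2), ?_, ?_, ?_, ?_, ?_⟩
  · intro κ hκ y hy
    have h1 := t1 _ (hlm κ hκ) y hy
    rw [← hpV κ hκ y ⟨hy0.trans_le hy.1, hy.2⟩, neg_sub] at h1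
    exact h1
  · intro κ hκ
    exact t2 _ (hlm κ hκ)
  · intro κ hκ
    have hpc : ContinuousOn (fun y => p (y, κ/h^2)) (Ioi 0) := by
      apply hp.comp (by fun_prop)
      intro y hy
      exact ⟨hy, mem_univ _⟩
    rw [← t3 _ (hlm κ hκ)]
    constructor
    · intro H
      exact eig_mp M l a α R xmax h κ hx hh s hs2 (fun y => ψ (y, κ/h^2)) (fun y => dψ (y, κ/h^2))
        (fun y => p (y, κ/h^2)) (fun y hy => hd1 y hy _) (fun y hy => hd2 y hy _)
        (hpV κ hκ) Cb hCb0 (fun y hy => hCb y hy _ (hlm κ hκ))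
        (nondegen ψ dψ p L (c0*h) _ hy0 hp (fun y hy => hd1 y hy _) (fun y hy => hd2 y hy _)
          (hpos _ (hlm κ hκ)))
        c hc (fun y hy => (hR y hy).1) H
    · intro H
      exact eig_mpr M l a α R xmax h κ hx hRcont s hs2 (fun y => ψ (y, κ/h^2))
        (fun y => dψ (y, κ/h^2))
        (fun y => p (y, κ/h^2)) (fun y hy => hd1 y hy _) (fun y hy => hd2 y hy _) hpc
        (hpV κ hκ) Cb hCb0 (fun y hy => hCb y hy _ (hlm κ hκ)) (c0*h) hy0 hc0L
        (hpos _ (hlm κ hκ) _ hy0 le_rfl) C hC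
        (fun y hy => ⟨(div_nonneg hc.le hy.1.le).trans (hR y hy).1, (hR y hy).2⟩) H
  · apply t4.comp (by fun_prop)
    exact fun κ hκ => hlm κ hκ
  · intro x hx y hy hxy
    exact t5 (hlm x hx) (hlm y hy) (div_lt_div_of_pos_right hxy hh2)

lemma pot_cont (M l a α : ℝ) (r : ℝ → ℝ) (S : Set ℝ) (hr : ContinuousOn r S)
    (hpos : ∀ y ∈ S, 0 < r y) :
    ContinuousOn (fun y => Vsig M l a (r y)) S ∧
    ContinuousOn (fun y => Vjunk M l a α (r y) + Vmass M l a α (r y)) S := by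
  have hρne : ∀ y ∈ S, ∀ n : ℕ, ((r y)^2 + a^2)^n ≠ 0 := by
    intro y hy n
    have := hpos y hy
    positivity
  have hDc : ContinuousOn (fun y => Dm M l a (r y)) S := by
    unfold Dm; fun_prop
  constructor
  · unfold Vsig
    exact hDc.div (by fun_prop) (fun y hy => hρne y hy 2)
  · unfold Vjunk Vmass
    have k1 : ContinuousOn (fun y => 3*(r y)^2*(Dm M l a (r y))^2/((r y)^2+a^2)^4) S :=
      ContinuousOn.div (by fun_prop) (by fun_prop) (fun y hy => hρne y hy 4)
    have k2 : ContinuousOn (fun y => Dm M l a (r y) * (5*(r y)^4/l^2 +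
        3*(r y)^2*(1+a^2/l^2) - 4*M*(r y) + a^2)/((r y)^2+a^2)^3) S :=
      ContinuousOn.div (by fun_prop) (by fun_prop) (fun y hy => hρne y hy 3)
    have k3 : ContinuousOn (fun y => Dm M l a (r y) * (r y)^2/((r y)^2+a^2)^2) S :=
      ContinuousOn.div (by fun_prop) (by fun_prop) (fun y hy => hρne y hy 2)
    have k4 : ContinuousOn (fun y => Dm M l a (r y) / ((r y)^2+a^2)^2) S :=
      ContinuousOn.div (by fun_prop) (by fun_prop) (fun y hy => hρne y hy 2)
    exact (((k1.neg.add k2).sub (continuousOn_const.mul k3)).sub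
      (((continuousOn_const.mul k4).mul continuousOn_const).mul continuousOn_const)).add
      (continuousOn_const.mul k3)

set_option maxHeartbeats 1000000 in
/-- Weyl's law for the Dirichlet problem P_DD(h): the number N(h) of
eigenvalues in [E−δ,E+δ] is finite for small h and 2πh·N(h) converges to the phase-space
volume Q as h → 0⁺. -/
theorem statement2 (M l a α : ℝ) (hM : 0 < M) (hl : 0 < l) (ha : |a| < l) (hα : α < 9/4)
    (rp : ℝ) (hrp : 0 < rp) (hrp0 : Dm M l a rp = 0)
    (hrppos : ∀ r, rp < r → 0 < Dm M l a r)
    (rmax : ℝ) (hrmax : rp < rmax)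
    (hmax : ∀ r ∈ Set.Ici rp, r ≠ rmax → Vsig M l a r < Vsig M l a rmax)
    (R : ℝ → ℝ) (hRmono : StrictMonoOn R (Set.Iio (π/2)))
    (hRim : R '' Set.Iio (π/2) = Set.Ioi rp)
    (hRderiv : ∀ x < π/2, HasDerivAt R (Dm M l a (R x) / ((R x)^2 + a^2)) x)
    (hRtop : Filter.Tendsto R (nhdsWithin (π/2) (Set.Iio (π/2))) Filter.atTop)
    (xmax : ℝ) (hxmax : xmax < π/2) (hRxmax : R xmax = rmax)
    (E δ : ℝ) (hE : E ∈ Set.Ioo (1/l^2) (Vsig M l a rmax)) (hδ : 0 < δ)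
    (hEδ : Set.Icc (E - δ) (E + δ) ⊆ Set.Ioo (1/l^2) (Vsig M l a rmax)) :
    ∃ h₀ > 0,
      (∀ h ∈ Set.Ioc (0:ℝ) h₀,
        ({κ | IsDirichletEigenvalue M l a α R xmax h κ} ∩ Set.Icc (E - δ) (E + δ)).Finite) ∧
      Filter.Tendsto
        (fun h : ℝ => 2 * π * h *
          (({κ | IsDirichletEigenvalue M l a α R xmax h κ} ∩ Set.Icc (E - δ) (E + δ)).ncard : ℝ))
        (nhdsWithin 0 (Set.Ioi 0))
        (nhds (2 * ∫ x in Set.Ioo xmax (π/2),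
          (Real.sqrt (max 0 (E + δ - Vsig M l a (R x)))
            - Real.sqrt (max 0 (E - δ - Vsig M l a (R x)))))) := by
  set L := π/2 - xmax with hL
  have hL0 : 0 < L := by linarith
  have hpi := pi_pos
  obtain ⟨hrge, hV, ⟨A0, hA0, hA⟩, ⟨c, hc, C, hC, hRb⟩⟩ := geom M l a α hM hl ha rp hrp hrppos rmax
    hrmax hmax R hRmono hRderiv hRtop xmax hxmax hRxmax
  have hrm0 : 0 < rmax := hrp.trans hrmax
  set Vm := Vsig M l a rmax with hVm
  have hE1 := hEδ (show E - δ ∈ Icc (E-δ) (E+δ) from ⟨le_rfl, by linarith⟩)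
  have hE2 := hEδ (show E + δ ∈ Icc (E-δ) (E+δ) from ⟨by linarith, le_rfl⟩)
  have hκ1 : 0 < E - δ := lt_trans (by positivity) hE1.1
  have hκ2 : E + δ ≤ Vm := hE2.2.le
  have hVm0 : 0 < Vm := by linarith
  have hRcont : ContinuousOn R (Iio (π/2)) := fun x hx =>
    (hRderiv x hx).continuousAt.continuousWithinAt
  have hrc : ContinuousOn (fun y => R (π/2 - y)) (Ioc 0 L) := by
    apply hRcont.comp (by fun_prop)
    intro y hy
    simp only [mem_Iio]; linarith [hy.1]
  have hrpos : ∀ y ∈ Ioc 0 L, 0 < R (π/2 - y) := fun y hy => hrm0.trans_le (hrge y hy)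
  obtain ⟨hVc, hBc⟩ := pot_cont M l a α (fun y => R (π/2 - y)) (Ioc 0 L) hrc hrpos
  obtain ⟨c0, hc0⟩ : ∃ c0, c0 = 1/(2*√(A0+Vm)) := ⟨_, rfl⟩
  have hk0 : 0 < √(A0+Vm) := Real.sqrt_pos.mpr (by linarith)
  have hc00 : 0 < c0 := by rw [hc0]; positivity
  obtain ⟨h1, hh1, hh11, hh1L⟩ : ∃ h1 > 0, h1 ≤ 1 ∧ c0 * h1 ≤ L := by
    refine ⟨min 1 (L/c0), by positivity, min_le_left _ _, ?_⟩
    calc _ ≤ c0 * (L/c0) := mul_le_mul_of_nonneg_left (min_le_right _ _) hc00.le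
      _ = L := by field_simp
  have hex : ∀ h, ∃ θ : ℝ → ℝ → ℝ, h ∈ Ioo 0 h1 →
      (∀ κ ∈ Icc (E-δ) (E+δ), ∀ y ∈ Icc (c0*h) L, HasDerivAt (fun y => θ y κ)
        ((cos (θ y κ)^2 + (κ - Vfull M l a α R h (π/2 - y)) * sin (θ y κ)^2)/h) y) ∧
      (∀ κ ∈ Icc (E-δ) (E+δ), θ (c0*h) κ ∈ Ioo 0 π) ∧
      (∀ κ ∈ Icc (E-δ) (E+δ), IsDirichletEigenvalue M l a α R xmax h κ ↔ sin (θ L κ) = 0) ∧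
      ContinuousOn (θ L) (Icc (E-δ) (E+δ)) ∧ StrictMonoOn (θ L) (Icc (E-δ) (E+δ)) := by
    intro h
    by_cases hh : h ∈ Ioo 0 h1
    · obtain ⟨θ, hθ⟩ := per_h M l a α hα R xmax h hxmax hh.1 (hh.2.le.trans hh11) hRcont
        (E-δ) (E+δ) Vm A0 c0 c C hκ1 (by linarith) hκ2 hA0 hc hC hRb hV hA hVc hBc hc0
        ((mul_le_mul_of_nonneg_left hh.2.le hc00.le).trans hh1L)
      exact ⟨θ, fun _ => hθ⟩
    · exact ⟨fun _ _ => 0, fun h' => absurd h' hh⟩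
  choose Θ hΘ using hex
  -- counting
  have hset : ∀ h ∈ Ioo 0 h1,
      {κ | IsDirichletEigenvalue M l a α R xmax h κ} ∩ Icc (E-δ) (E+δ) =
      {κ | κ ∈ Icc (E-δ) (E+δ) ∧ sin (Θ h L κ) = 0} := by
    intro h hh
    ext κ
    simp only [mem_inter_iff, mem_ofPred_eq]
    constructor
    · rintro ⟨k1, k2⟩
      exact ⟨k2, ((hΘ h hh).2.2.1 κ k2).mp k1⟩
    · rintro ⟨k1, k2⟩
      exact ⟨((hΘ h hh).2.2.1 κ k1).mpr k2, k1⟩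
  have hcount : ∀ h ∈ Ioo 0 h1, _ := fun h hh =>
    count_lemma (Θ h L) (E-δ) (E+δ) (by linarith) (hΘ h hh).2.2.2.1 (hΘ h hh).2.2.2.2
  -- asymptotics
  have hVfull : ∀ h y, Vfull M l a α R h (π/2 - y) = Vsig M l a (R (π/2 - y)) + h^2 *
      ((Vjunk M l a α (R (π/2 - y)) + Vmass M l a α (R (π/2 - y)) - (2-α)/y^2) + (2-α)/y^2) := by
    intro h y; rw [Vfull]; ring
  have hasy : ∀ κ ∈ Icc (E-δ) (E+δ), Tendsto (fun h => h * Θ h L κ) (𝓝[>] 0)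
      (𝓝 (∫ y in (0:ℝ)..L, √(max 0 (κ - Vsig M l a (R (π/2 - y)))))) := by
    intro κ hκ
    have hκ0 : 0 < κ := hκ1.trans_le hκ.1
    have hκm : κ ≤ Vm := hκ.2.trans hκ2
    have hM1 : 0 < Vm + A0 + |2-α|/c0^2 := by positivity
    apply angle_asymp L c0 h1 Vm (√(Vm + A0 + |2-α|/c0^2)) hL0 hc00 hh1
      (Real.sqrt_pos.mpr hM1) (fun y => κ - Vsig M l a (R (π/2 - y)))
      (continuousOn_const.sub hVc) _
      (fun h y => κ - Vfull M l a α R h (π/2 - y)) (fun h y => Θ h y κ)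
    · intro h hh y hy
      have hh0 : 0 < h := hh.1
      have hy0 : 0 < y := (mul_pos hc00 hh0).trans_le hy.1
      have hyL : y ∈ Ioc 0 L := ⟨hy0, hy.2⟩
      rw [Real.sq_sqrt hM1.le, hVfull]
      have e1 := (abs_le.mp (hA y hyL)).1
      have hh2 : h^2 ≤ 1 := pow_le_one₀ hh0.le (hh.2.le.trans hh11)
      have e2 : -(h^2 * ((2-α)/y^2)) ≤ |2-α|/c0^2 := by
        have h3 : (c0*h)^2 ≤ y^2 := pow_le_pow_left₀ (by positivity) hy.1 2
        have h4 : -(h^2 * ((2-α)/y^2)) ≤ h^2 * (|2-α|/y^2) := by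
          have : -((2-α)/y^2) ≤ |2-α|/y^2 := by
            rw [← neg_div]
            exact div_le_div_of_nonneg_right (neg_le_abs _) (by positivity)
          rw [← mul_neg]
          exact mul_le_mul_of_nonneg_left this (by positivity)
        refine h4.trans ?_
        rw [← mul_div_assoc, div_le_div_iff₀ (by positivity) (by positivity)]
        calc _ = |2-α| * (c0*h)^2 := by ring
          _ ≤ _ := mul_le_mul_of_nonneg_left h3 (abs_nonneg _)
      have e3 : -(h^2 * (Vjunk M l a α (R (π/2 - y)) + Vmass M l a α (R (π/2 - y)) - (2-α)/y^2))
          ≤ A0 := by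
        have h3 : h^2 * (-(Vjunk M l a α (R (π/2 - y)) + Vmass M l a α (R (π/2 - y)) - (2-α)/y^2))
          ≤ h^2 * A0 := mul_le_mul_of_nonneg_left (by linarith) (by positivity)
        have h4 : h^2 * A0 ≤ A0 := mul_le_of_le_one_left hA0.le hh2
        rw [← mul_neg]
        exact h3.trans h4
      rw [mul_add]
      linarith [(hV y hyL).1]
    · intro ε hε η hη
      refine ⟨min 1 (η / (A0 + |2-α|/ε^2)), by positivity, ?_⟩
      intro h hh y hy
      have hh0 : 0 < h := hh.1
      have hy0 : 0 < y := hε.trans_le hy.1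
      have hyL : y ∈ Ioc 0 L := ⟨hy0, hy.2⟩
      have q1 : h ≤ 1 := hh.2.le.trans (min_le_left _ _)
      have q2 : h ≤ η / (A0 + |2-α|/ε^2) := hh.2.le.trans (min_le_right _ _)
      have e1 : κ - Vfull M l a α R h (π/2 - y) - (κ - Vsig M l a (R (π/2 - y))) =
        -(h^2 * ((Vjunk M l a α (R (π/2 - y)) + Vmass M l a α (R (π/2 - y)) - (2-α)/y^2) +
          (2-α)/y^2)) := by rw [hVfull]; ring
      have e2 : |(Vjunk M l a α (R (π/2 - y)) + Vmass M l a α (R (π/2 - y)) - (2-α)/y^2) +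
          (2-α)/y^2| ≤ A0 + |2-α|/ε^2 := by
        refine (abs_add_le _ _).trans (add_le_add (hA y hyL) ?_)
        rw [abs_div, abs_of_pos (by positivity : 0 < y^2)]
        exact div_le_div_of_nonneg_left (abs_nonneg _) (by positivity)
          (pow_le_pow_left₀ hε.le hy.1 2)
      have hD0 : 0 < A0 + |2-α|/ε^2 := by positivity
      change |κ - Vfull M l a α R h (π/2 - y) - (κ - Vsig M l a (R (π/2 - y)))| ≤ η
      rw [e1, abs_neg, abs_mul, abs_of_pos (by positivity : 0 < h^2)]
      calc _ ≤ h^2 * (A0 + |2-α|/ε^2) := mul_le_mul_of_nonneg_left e2 (by positivity)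
        _ ≤ h * (A0 + |2-α|/ε^2) := by
            apply mul_le_mul_of_nonneg_right _ hD0.le
            nlinarith
        _ ≤ (η / (A0 + |2-α|/ε^2)) * (A0 + |2-α|/ε^2) := mul_le_mul_of_nonneg_right q2 hD0.le
        _ = η := by field_simp
    · intro h hh y hy
      exact (hΘ h hh).1 κ hκ y hy
    · intro h hh
      exact (hΘ h hh).2.1 κ hκ
    · intro y hy
      have := hV y hy
      rw [abs_le]
      constructor <;> linarith [this.1, this.2]
  refine ⟨h1/2, by positivity, ?_, ?_⟩
  · intro h hh
    have hh' : h ∈ Ioo 0 h1 := ⟨hh.1, by linarith [hh.2]⟩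
    rw [hset h hh']
    exact (hcount h hh').1
  · -- the limit
    have hlim := ((hasy (E+δ) ⟨by linarith, le_rfl⟩).sub (hasy (E-δ) ⟨le_rfl, by linarith⟩)).const_mul 2
    have hSint : ∀ κ, IntervalIntegrable (fun y => √(max 0 (κ - Vsig M l a (R (π/2 - y))))) volume
        0 L := by
      intro κ
      rw [intervalIntegrable_iff_integrableOn_Ioc_of_le hL0.le]
      have hcst : IntegrableOn (fun _ : ℝ => √|κ|) (Ioc 0 L) := by simp
      refine Integrable.mono' hcst (ContinuousOn.aestronglyMeasurable
        (continuousOn_const.sup (continuousOn_const.sub hVc)).sqrt measurableSet_Ioc) ?_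
      rw [ae_restrict_iff' measurableSet_Ioc]
      filter_upwards with y hy
      rw [Real.norm_of_nonneg (Real.sqrt_nonneg _)]
      apply Real.sqrt_le_sqrt
      exact max_le (abs_nonneg _) (by linarith [(hV y hy).1, le_abs_self κ])
    have hQ : (∫ x in Set.Ioo xmax (π/2),
          (Real.sqrt (max 0 (E + δ - Vsig M l a (R x)))
            - Real.sqrt (max 0 (E - δ - Vsig M l a (R x))))) =
        (∫ y in (0:ℝ)..L, √(max 0 (E + δ - Vsig M l a (R (π/2 - y))))) -
        ∫ y in (0:ℝ)..L, √(max 0 (E - δ - Vsig M l a (R (π/2 - y)))) := by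
      rw [← intervalIntegral.integral_sub (hSint _) (hSint _),
        intervalIntegral.integral_comp_sub_left (fun x => √(max 0 (E + δ - Vsig M l a (R x)))
            - √(max 0 (E - δ - Vsig M l a (R x)))) (π/2)]
      have e1 : π/2 - L = xmax := by rw [hL]; ring
      rw [e1, sub_zero, intervalIntegral.integral_of_le hxmax.le, integral_Ioc_eq_integral_Ioo]
    rw [hQ]
    have hz : Tendsto (fun h : ℝ => 2 * π * h *
          (({κ | IsDirichletEigenvalue M l a α R xmax h κ} ∩ Set.Icc (E - δ) (E + δ)).ncard : ℝ)
          - 2 * (h * Θ h L (E+δ) - h * Θ h L (E-δ))) (𝓝[>] 0) (𝓝 0) := by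
      have hb : Tendsto (fun h : ℝ => 2*π*h) (𝓝[>] 0) (𝓝 0) := by
        have : Tendsto (fun h : ℝ => 2*π*h) (𝓝 0) (𝓝 (2*π*0)) := tendsto_id.const_mul _
        rw [mul_zero] at this
        exact this.mono_left nhdsWithin_le_nhds
      apply squeeze_zero_norm' _ hb
      filter_upwards [Ioo_mem_nhdsGT hh1] with h hh
      have k := (hcount h hh).2
      rw [hset h hh, Real.norm_eq_abs]
      have hh0 : 0 < h := hh.1
      have e : ∀ N : ℝ, 2*π*h*N - 2*(h * Θ h L (E+δ) - h * Θ h L (E-δ)) =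
        2*h*(π*N - (Θ h L (E+δ) - Θ h L (E-δ))) := by intro N; ring
      rw [e, abs_mul, abs_of_pos (by positivity : 0 < 2*h)]
      calc _ ≤ 2*h*π := mul_le_mul_of_nonneg_left k (by positivity)
        _ = _ := by ring
    have hfin := hz.add hlim
    rw [zero_add] at hfin
    refine hfin.congr (fun h => ?_)
    ring
end

section
/- Fix real parameters M>0, l>0, a with |a|<l, and α<9/4. Then there exists H₀>0 (depending only on M, l, a, α) such that for every h ∈ (0, H₀] and every eigenvalue κ of the Dirichlet problem P_DD(h), one has κ > 1/l². -/
open Real MeasureTheory Set Filter Topology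

lemma aux_sig (M l a r : ℝ) (hl : 0 < l) (hr : 0 < r) :
    Vsig M l a r - 1/l^2 = ((1 - a^2/l^2)*(r^2+a^2) - 2*M*r)/(r^2+a^2)^2 := by
  have h1 : r^2+a^2 ≠ 0 := by positivity
  unfold Vsig Dm
  field_simp
  ring

lemma aux_Q (M l a : ℝ) (hM : 0 < M) (hl : 0 < l) (ha : |a| < l)
    (rp : ℝ) (hrp : 0 < rp)
    (rmax : ℝ) (hrmax : rp < rmax)
    (hmax : ∀ r ∈ Set.Ici rp, r ≠ rmax → Vsig M l a r < Vsig M l a rmax)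
    (r : ℝ) (hr : rmax ≤ r) : 1/l^2 < Vsig M l a r := by
  have hm0 : 0 < rmax := hrp.trans hrmax
  have hr0 : 0 < r := hm0.trans_le hr
  have hXi : 0 < 1 - a^2/l^2 := by
    have : a^2 < l^2 := sq_lt_sq' (by linarith [neg_abs_le a]) (by linarith [le_abs_self a])
    have h2 : a^2/l^2 < 1 := (div_lt_one (by positivity)).2 this
    linarith
  set X := 1 - a^2/l^2 with hX
  have key : ∀ s, 0 < s → (1/l^2 < Vsig M l a s ↔ 0 < X*(s^2+a^2) - 2*M*s) := by
    intro s hs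
    have h := aux_sig M l a s hl hs
    rw [← hX] at h
    have h2 : 0 < (s^2+a^2)^2 := by positivity
    rw [← sub_pos, h, div_pos_iff_of_pos_right h2]
  have hQm : 0 < X*(rmax^2+a^2) - 2*M*rmax := by
    rw [← key rmax hm0]
    set s := rmax + 2*M/X with hs
    have h1 : 0 < 2*M/X := by positivity
    have h2 : X * s = X * rmax + 2*M := by rw [hs]; field_simp
    have hs0 : 0 < s := by linarith
    have h3 : 1/l^2 < Vsig M l a s := by
      rw [key s hs0]
      have : X*(s^2+a^2) - 2*M*s = X*rmax*s + X*a^2 := by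
        linear_combination s * h2
      rw [this]; positivity
    exact h3.trans (hmax s (by simp only [Set.mem_Ici]; linarith) (by linarith [h1] |> ne_of_gt))
  have hloc : IsLocalMax (Vsig M l a) rmax := by
    filter_upwards [Ioi_mem_nhds hrmax] with s hs
    by_cases h : s = rmax
    · rw [h]
    · exact (hmax s (mem_Ici.2 (le_of_lt hs)) h).le
  have hder : HasDerivAt (Vsig M l a)
      ((((2*rmax/l^2)*(rmax^2+a^2) + (1+rmax^2/l^2)*(2*rmax) - 2*M)*(rmax^2+a^2)^2
        - Dm M l a rmax * (2*(rmax^2+a^2)*(2*rmax)))/((rmax^2+a^2)^2)^2) rmax := by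
    have hp : HasDerivAt (fun s : ℝ => s^2) (2*rmax) rmax := by simpa using hasDerivAt_pow 2 rmax
    have hD : HasDerivAt (Dm M l a)
      ((2*rmax/l^2)*(rmax^2+a^2) + (1+rmax^2/l^2)*(2*rmax) - 2*M) rmax := by
      have := (((hp.div_const (l^2)).const_add 1).mul (hp.add_const (a^2))).sub
        ((hasDerivAt_id rmax).const_mul (2*M))
      exact this.congr_deriv (by simp)
    have hE := (hp.add_const (a^2)).pow 2
    have := hD.div hE (by simp only [Pi.pow_apply]; positivity)
    exact this.congr_deriv (by simp)
  have h0 := hloc.hasDerivAt_eq_zero hder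
  have hq : rmax^2+a^2 ≠ 0 := by positivity
  have hpz : X*rmax*(rmax^2+a^2) - 3*M*rmax^2 + M*a^2 = 0 := by
    rw [hX]
    unfold Dm at h0
    field_simp at h0 ⊢
    linear_combination (-1/2) * h0
  have hra : a^2 < rmax^2 := by
    have : 0 < rmax * (X*(rmax^2+a^2) - 2*M*rmax) := by positivity
    have : 0 < M * (rmax^2 - a^2) := by nlinarith
    have := (pos_iff_pos_of_mul_pos this).1 hM
    linarith
  rw [key r hr0]
  have h5 : rmax * (X*(r^2+a^2) - 2*M*r) = r * (X*(rmax^2+a^2) - 2*M*rmax)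
      + X * (r - rmax) * (r*rmax - a^2) := by ring
  have h6 : 0 ≤ r*rmax - a^2 := by nlinarith
  have h7 : 0 < rmax * (X*(r^2+a^2) - 2*M*r) := by
    rw [h5]
    have : 0 ≤ r - rmax := by linarith
    positivity
  exact (pos_iff_pos_of_mul_pos h7).1 hm0

/-- the h-independent part of the Hardy-corrected potential -/
noncomputable def Epot (M l a α r : ℝ) : ℝ :=
  Vjunk M l a α r + Vmass M l a α r + (Dm M l a r / (r^2+a^2))/(2*l^2) - (r/(2*l^2))^2

lemma aux_infty (M l a α : ℝ) (hl : 0 < l) (hα : α < 9/4) :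
    ∀ᶠ r in atTop, 0 < Epot M l a α r := by
  set d : ℝ → ℝ := fun t => (t^2+1/l^2)*(1+a^2*t^2) - 2*M*t^3 with hd
  set e : ℝ → ℝ := fun t => 1 + a^2*t^2 with he
  set K : ℝ → ℝ := fun t => -(3*(d t)^2/(e t)^4)
    + d t * (5/l^2+3*t^2*(1+a^2/l^2) - 4*M*t^3+a^2*t^4)/(e t)^3 - (2/l^2)*(d t/(e t)^2)
    - (α/l^2)*(d t/(e t)^2)*Th α*a^2*t^2 + ((2-α)/l^2)*(d t/(e t)^2) + (d t/e t)/(2*l^2)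
    - 1/(2*l^2)^2 with hK
  have hepos : ∀ t, e t ≠ 0 := fun t => by simp only [he]; positivity
  have hdc : Continuous d := by fun_prop
  have hec : Continuous e := by fun_prop
  have hKc : Continuous K := by
    have h2 : ∀ t, (e t)^2 ≠ 0 := fun t => pow_ne_zero _ (hepos t)
    have h3 : ∀ t, (e t)^3 ≠ 0 := fun t => pow_ne_zero _ (hepos t)
    have h4 : ∀ t, (e t)^4 ≠ 0 := fun t => pow_ne_zero _ (hepos t)
    have c1 : Continuous fun t => d t / e t := hdc.div hec hepos
    have c2 : Continuous fun t => d t / (e t)^2 := hdc.div (hec.pow 2) h2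
    have c3 : Continuous fun t => d t * (5/l^2+3*t^2*(1+a^2/l^2) - 4*M*t^3+a^2*t^4)/(e t)^3 :=
      (hdc.mul (by fun_prop)).div (hec.pow 3) h3
    have c4 : Continuous fun t => 3*(d t)^2/(e t)^4 := (by fun_prop : Continuous fun t => 3*(d t)^2).div (hec.pow 4) h4
    simp only [hK]
    clear_value d e
    fun_prop
  have hK0 : 0 < K 0 := by
    have : K 0 = (9/4 - α)/l^4 := by
      simp only [hK, hd, he]
      field_simp
      ring
    rw [this]
    have : 0 < 9/4 - α := by linarith
    positivity
  have hev : ∀ᶠ r : ℝ in atTop, 0 < K (r⁻¹) :=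
    (hKc.continuousAt.tendsto.comp tendsto_inv_atTop_zero).eventually (lt_mem_nhds hK0)
  filter_upwards [hev, eventually_gt_atTop 0] with r h1 h2
  have : Epot M l a α r = r^2 * K (r⁻¹) := by
    have hq : r^2+a^2 ≠ 0 := by positivity
    have hd' : d r⁻¹ = Dm M l a r / r^4 := by
      simp only [hd, Dm]; field_simp
    have he' : e r⁻¹ = (r^2+a^2)/r^2 := by
      simp only [he]; field_simp
    simp only [hK, hd', he', Epot, Vjunk, Vmass]
    generalize Dm M l a r = D
    generalize Th α = T
    field_simp
  rw [this]; positivity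

lemma aux_cont (M l a α : ℝ) (s : Set ℝ) (hs : ∀ r ∈ s, 0 < r) :
    ContinuousOn (Epot M l a α) s ∧ ContinuousOn (Vsig M l a) s := by
  have hq : ∀ r ∈ s, r^2+a^2 ≠ 0 := fun r hr => by have := hs r hr; positivity
  have h2 : ∀ r ∈ s, (r^2+a^2)^2 ≠ 0 := fun r hr => pow_ne_zero _ (hq r hr)
  have h3 : ∀ r ∈ s, (r^2+a^2)^3 ≠ 0 := fun r hr => pow_ne_zero _ (hq r hr)
  have h4 : ∀ r ∈ s, (r^2+a^2)^4 ≠ 0 := fun r hr => pow_ne_zero _ (hq r hr)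
  constructor
  · unfold Epot Vjunk Vmass Dm
    fun_prop (disch := assumption)
  · unfold Vsig Dm
    fun_prop (disch := assumption)

lemma aux_H (M l a α : ℝ) (hl : 0 < l) (hα : α < 9/4) (rmax : ℝ) (hm0 : 0 < rmax)
    (hV : ∀ r, rmax ≤ r → 1/l^2 < Vsig M l a r) :
    ∃ H₀ > 0, ∀ h ∈ Set.Ioc 0 H₀, ∀ r, rmax ≤ r →
      0 < (Vsig M l a r - 1/l^2) + h^2 * Epot M l a α r := by
  obtain ⟨r1, hr1⟩ := eventually_atTop.1 (aux_infty M l a α hl hα)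
  set r2 := max r1 rmax
  have hne : (Set.Icc rmax r2).Nonempty := ⟨rmax, by simp [r2]⟩
  obtain ⟨c1, c2⟩ := aux_cont M l a α (Set.Icc rmax r2) (fun r hr => hm0.trans_le hr.1)
  obtain ⟨p, hp, hp'⟩ := isCompact_Icc.exists_isMinOn hne c1
  obtain ⟨q, hq, hq'⟩ := isCompact_Icc.exists_isMinOn hne c2
  set c := Vsig M l a q - 1/l^2 with hc
  have hc0 : 0 < c := by have := hV q hq.1; linarith
  set C := |Epot M l a α p| + 1 with hC
  have hC0 : 0 < C := by positivity
  refine ⟨√(c/(2*C)), Real.sqrt_pos.2 (by positivity), fun h hh r hr => ?_⟩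
  have hh2 : 0 < h^2 := pow_pos hh.1 2
  by_cases hrr : r ≤ r2
  · have e1 : Epot M l a α p ≤ Epot M l a α r := hp' ⟨hr, hrr⟩
    have e2 : Vsig M l a q ≤ Vsig M l a r := hq' ⟨hr, hrr⟩
    have e3 : h^2 ≤ c/(2*C) := (Real.le_sqrt' hh.1).1 hh.2
    have e4 : h^2 * (2*C) ≤ c := (le_div_iff₀ (by positivity)).1 e3
    have e5 := neg_abs_le (Epot M l a α p)
    have e6 : -C ≤ Epot M l a α r := by linarith
    nlinarith
  · have e1 := hr1 r (le_trans (le_max_left _ _) (le_of_not_ge hrr))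
    have e2 := hV r hr
    have := mul_pos hh2 e1
    linarith

theorem statement4 (M l a α : ℝ) (hM : 0 < M) (hl : 0 < l) (ha : |a| < l) (hα : α < 9/4)
    (rp : ℝ) (hrp : 0 < rp) (hrp0 : Dm M l a rp = 0)
    (hrppos : ∀ r, rp < r → 0 < Dm M l a r)
    (rmax : ℝ) (hrmax : rp < rmax)
    (hmax : ∀ r ∈ Set.Ici rp, r ≠ rmax → Vsig M l a r < Vsig M l a rmax)
    (R : ℝ → ℝ) (hRmono : StrictMonoOn R (Set.Iio (π/2)))
    (hRim : R '' Set.Iio (π/2) = Set.Ioi rp)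
    (hRderiv : ∀ x < π/2, HasDerivAt R (Dm M l a (R x) / ((R x)^2 + a^2)) x)
    (hRtop : Filter.Tendsto R (nhdsWithin (π/2) (Set.Iio (π/2))) Filter.atTop)
    (xmax : ℝ) (hxmax : xmax < π/2) (hRxmax : R xmax = rmax)
    :
    ∃ H₀ > 0, ∀ h ∈ Set.Ioc 0 H₀, ∀ κ : ℝ,
      IsDirichletEigenvalue M l a α R xmax h κ → 1/l^2 < κ := by
  have hm0 : 0 < rmax := hrp.trans hrmax
  have hV := aux_Q M l a hM hl ha rp hrp rmax hrmax hmax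
  obtain ⟨H₀, hH0, hH⟩ := aux_H M l a α hl hα rmax hm0 hV
  refine ⟨H₀, hH0, fun h hh κ hev => ?_⟩
  by_contra hκ
  rw [not_lt] at hκ
  obtain ⟨u, ⟨x0, hx0, hux0⟩, hu, hode, hub, hint⟩ := hev
  have hh2 : 0 < h^2 := pow_pos hh.1 2
  have hR : ∀ x ∈ Ico xmax (π/2), rmax ≤ R x := fun x hx => by
    rw [← hRxmax]; exact hRmono.monotoneOn hxmax hx.2 hx.1
  set I := Ico xmax (π/2) with hI
  have hIint : interior I = Ioo xmax (π/2) := interior_Ico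
  set u1 := derivWithin u I with hu1
  have hnh : ∀ x ∈ Ioo xmax (π/2), I ∈ 𝓝 x := fun x hx => Ico_mem_nhds hx.1 hx.2
  have hu1eq : ∀ x ∈ Ioo xmax (π/2), u1 x = deriv u x := fun x hx =>
    derivWithin_of_mem_nhds (hnh x hx)
  have hu1c : ContDiffOn ℝ 1 u1 I :=
    hu.derivWithin (uniqueDiffOn_Ico _ _) (by norm_num)
  have hud : ∀ x ∈ Ioo xmax (π/2), HasDerivAt u (u1 x) x := fun x hx => by
    rw [hu1eq x hx]
    exact ((hu.differentiableOn (by norm_num)) x ⟨hx.1.le, hx.2⟩).differentiableAt (hnh x hx)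
      |>.hasDerivAt
  have hu1d : ∀ x ∈ Ioo xmax (π/2), HasDerivAt u1 (deriv (deriv u) x) x := fun x hx => by
    have h1 := ((hu1c.differentiableOn (by norm_num)) x ⟨hx.1.le, hx.2⟩).differentiableAt
      (hnh x hx) |>.hasDerivAt
    have h2 : u1 =ᶠ[𝓝 x] deriv u := by
      filter_upwards [Ioo_mem_nhds hx.1 hx.2] with y hy using hu1eq y hy
    rwa [h2.deriv_eq] at h1
  have hRc : ContinuousOn R I := fun x hx => (hRderiv x hx.2).continuousAt.continuousWithinAt
  set G : ℝ → ℝ := fun x => u x * u1 x + R x/(2*l^2) * (u x)^2 with hG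
  have hGc : ContinuousOn G I :=
    (hu.continuousOn.mul hu1c.continuousOn).add
      ((hRc.div_const _).mul (hu.continuousOn.pow 2))
  have hG0 : G xmax = 0 := by simp [hG, hub]
  have hGd : ∀ x ∈ Ioo xmax (π/2), ∃ g, HasDerivAt G g x ∧ 0 ≤ g ∧ (u x ≠ 0 → 0 < g) := by
    intro x hx
    have hxI : x ∈ I := ⟨hx.1.le, hx.2⟩
    have hd := ((hud x hx).mul (hu1d x hx)).add
      (((hRderiv x hx.2).div_const (2*l^2)).mul ((hud x hx).pow 2))
    refine ⟨_, hd, ?_⟩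
    have hpos := hH h hh (R x) (hR x hxI)
    have ho := hode x hx
    unfold Vfull at ho
    set P := (Vsig M l a (R x) - κ) + h^2 * Epot M l a α (R x) with hP
    have hPpos : 0 < P := by linarith
    set g := u1 x * u1 x + u x * deriv (deriv u) x +
       (Dm M l a (R x) / (R x ^ 2 + a ^ 2) / (2 * l ^ 2) * u x ^ 2 +
       R x / (2 * l ^ 2) * (2 * u x * u1 x)) with hg
    have hmain : h^2 * g = h^2 * (u1 x + R x/(2*l^2) * u x)^2 + P * (u x)^2 := by
      rw [hg, hP]
      unfold Epot
      linear_combination (-u x) * ho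
    have hgen : u1 x * u1 x + u x * deriv (deriv u) x +
       (Dm M l a (R x) / (R x ^ 2 + a ^ 2) / (2 * l ^ 2) * (u ^ 2) x +
       R x / (2 * l ^ 2) * (((2:ℕ):ℝ) * u x ^ (2-1) * u1 x)) = g := by
      rw [hg]; simp
    rw [hgen]
    constructor
    · have : 0 ≤ h^2 * g := by rw [hmain]; positivity
      exact nonneg_of_mul_nonneg_right this hh2
    · intro hne
      have : 0 < h^2 * g := by rw [hmain]; positivity
      exact (pos_iff_pos_of_mul_pos this).1 hh2
  have hGmono : MonotoneOn G I := by
    refine monotoneOn_of_deriv_nonneg (convex_Ico _ _) hGc ?_ ?_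
    · rw [hIint]
      intro x hx
      obtain ⟨g, hg, -⟩ := hGd x hx
      exact hg.differentiableAt.differentiableWithinAt
    · rw [hIint]
      intro x hx
      obtain ⟨g, hg, hg', -⟩ := hGd x hx
      rwa [hg.deriv]
  have hxmI : xmax ∈ I := ⟨le_rfl, hxmax⟩
  have hx0' : x0 ∈ Ioo xmax (π/2) := by
    refine ⟨lt_of_le_of_ne hx0.1 ?_, hx0.2⟩
    rintro rfl
    exact hux0 hub
  obtain ⟨x2, hx2, hGx2⟩ : ∃ x2 ∈ I, 0 < G x2 := by
    by_contra hcon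
    push Not at hcon
    have hz : ∀ x ∈ I, G x = 0 := fun x hx =>
      le_antisymm (hcon x hx) (hG0 ▸ hGmono hxmI hx hx.1)
    obtain ⟨g, hg, -, hg'⟩ := hGd x0 hx0'
    have h1 : G =ᶠ[𝓝 x0] fun _ => (0:ℝ) := by
      filter_upwards [hnh x0 hx0'] with y hy using hz y hy
    have h2 := h1.deriv_eq
    rw [hg.deriv, deriv_const] at h2
    exact (hg' hux0).ne' h2
  set c := G x2
  have hsub : Ioo x2 (π/2) ⊆ Ioo xmax (π/2) := Ioo_subset_Ioo_left hx2.1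
  have hRint : IntegrableOn R (Ioo x2 (π/2)) := by
    have hi := (hint.mono_set hsub).const_mul ((1/2 + 1/(2*l^2))/c)
    refine Integrable.mono' hi ?_ ?_
    · exact (hRc.mono (hsub.trans Ioo_subset_Ico_self)).aestronglyMeasurable measurableSet_Ioo
    · filter_upwards [ae_restrict_mem measurableSet_Ioo] with x hx
      have hx' := hsub hx
      have hxI : x ∈ I := ⟨hx'.1.le, hx'.2⟩
      have hRx : 0 < R x := hm0.trans_le (hR x hxI)
      have hGx : c ≤ G x := hGmono hx2 hxI hx.1.le
      rw [Real.norm_eq_abs, abs_of_pos hRx, div_mul_eq_mul_div, le_div_iff₀ hGx2, ← hu1eq x hx']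
      have h1 : R x * c ≤ R x * G x := mul_le_mul_of_nonneg_left hGx hRx.le
      have h2 : R x * G x = (R x * u x) * u1 x + (1/(2*l^2)) * (R x^2 * u x^2) := by
        simp only [hG]; ring
      have h3 : 0 ≤ (1/(2*l^2)) * (u1 x)^2 := by positivity
      nlinarith [sq_nonneg (R x * u x - u1 x)]
  refine not_integrableOn_of_tendsto_norm_atTop_of_deriv_isBigO_filter
    (f := fun x => Real.log (R x)) (g := R) (l := 𝓝[<] (π/2)) (k := Ioo x2 (π/2))
    (Ioo_mem_nhdsLT hx2.2) ?_ ?_ ?_ hRint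
  · filter_upwards [Ioo_mem_nhdsLT hxmax] with x hx
    have hRx : 0 < R x := hm0.trans_le (hR x ⟨hx.1.le, hx.2⟩)
    exact ((hRderiv x hx.2).log hRx.ne').differentiableAt
  · exact tendsto_norm_atTop_atTop.comp (Real.tendsto_log_atTop.comp hRtop)
  · refine Asymptotics.IsBigO.of_bound (1 + 1/l^2) ?_
    filter_upwards [Ioo_mem_nhdsLT hxmax, hRtop.eventually_ge_atTop 1] with x hx hx1
    have hRx : 0 < R x := by linarith
    have hD := hrppos (R x) (hrmax.trans_le (hR x ⟨hx.1.le, hx.2⟩))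
    rw [((hRderiv x hx.2).log hRx.ne').deriv, Real.norm_eq_abs, Real.norm_eq_abs, abs_of_pos hRx,
      abs_of_pos (by positivity), div_le_iff₀ hRx, div_le_iff₀ (by positivity)]
    have h1 : Dm M l a (R x) ≤ (1 + R x^2/l^2) * (R x^2+a^2) := by
      unfold Dm; nlinarith [mul_pos hM hRx]
    refine h1.trans ?_
    gcongr
    have : (1 + 1/l^2) * R x * R x = R x^2 + R x^2/l^2 := by ring
    rw [this]
    nlinarith
end

section
/- Fix real parameters M>0, l>0, and a with |a|<l, and assume r₊>0 satisfies Δ₋(r₊)=0 and Δ₋(r)>0 for all r>r₊. Then there exists a unique r_max ∈ (r₊, ∞) such that V_σ attains its maximum over [r₊,∞) at r_max; moreover V_σ′(r) > 0 for all r ∈ (r₊, r_max), V_σ′(r) < 0 for all r > r_max (so V_σ is strictly decreasing on [r_max, ∞)), V_σ(r) < V_σ(r_max) for every r ∈ [r₊,∞) with r ≠ r_max, and r_max ≤ 3M/Ξ. -/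
open Real MeasureTheory Set Filter Topology

/-- The reduced derivative of `Vsig`, up to a positive factor (`k` is Ξ). -/
noncomputable def gaux (M a k r : ℝ) : ℝ := -k*r + 3*M - k*a^2/r - M*a^2/r^2

lemma gaux_concave (M a k x y z : ℝ) (hM : 0 < M) (hk : 0 < k) (hx : 0 < x) (hxy : x < y)
    (hyz : y < z) :
    (z-y) * gaux M a k x + (y-x) * gaux M a k z ≤ (z-x) * gaux M a k y := by
  have hy : 0 < y := hx.trans hxy
  have hz : 0 < z := hy.trans hyz
  have e : (z-x) * gaux M a k y - ((z-y) * gaux M a k x + (y-x) * gaux M a k z)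
      = k*a^2*((z-x)*(z-y)*(y-x))/(x*y*z)
        + M*a^2*((z-x)*(z-y)*(y-x)*(x*y+y*z+z*x))/(x*y*z)^2 := by
    unfold gaux
    field_simp
    ring
  have h1 : 0 < z - x := by linarith
  have h2 : 0 < z - y := by linarith
  have h3 : 0 < y - x := by linarith
  have : 0 ≤ k*a^2*((z-x)*(z-y)*(y-x))/(x*y*z)
        + M*a^2*((z-x)*(z-y)*(y-x)*(x*y+y*z+z*x))/(x*y*z)^2 := by positivity
  linarith

lemma Vsig_hasDerivAt (M l a r : ℝ) (hl : 0 < l) (hr : 0 < r) :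
    HasDerivAt (Vsig M l a) (2*r^2/(r^2+a^2)^3 * gaux M a (1 - a^2/l^2) r) r := by
  have hs : r^2+a^2 ≠ 0 := by positivity
  have hp : HasDerivAt (fun r : ℝ => r^2) (2*r) r := by simpa using hasDerivAt_pow 2 r
  have hsd := hp.add_const (a^2)
  have hD := (((hp.div_const (l^2)).const_add 1).mul hsd).sub ((hasDerivAt_id r).const_mul (2*M))
  have hV := hD.div (hsd.pow 2) (pow_ne_zero 2 hs)
  refine HasDerivAt.congr_deriv (f := Vsig M l a) hV ?_
  simp only [gaux, Pi.mul_apply, Pi.sub_apply, Pi.pow_apply, id]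
  field_simp
  ring

/-- existence, uniqueness and properties of the maximizer of V_σ on [r₊,∞). -/
theorem statement5 (M l a : ℝ) (hM : 0 < M) (hl : 0 < l) (ha : |a| < l)
    (rp : ℝ) (hrp : 0 < rp) (hrp0 : Dm M l a rp = 0)
    (hrppos : ∀ r, rp < r → 0 < Dm M l a r) :
    ∃ rmax : ℝ, rp < rmax ∧
      IsMaxOn (Vsig M l a) (Set.Ici rp) rmax ∧
      (∀ r', rp < r' → IsMaxOn (Vsig M l a) (Set.Ici rp) r' → r' = rmax) ∧
      (∀ r ∈ Set.Ioo rp rmax, 0 < deriv (Vsig M l a) r) ∧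
      (∀ r, rmax < r → deriv (Vsig M l a) r < 0) ∧
      StrictAntiOn (Vsig M l a) (Set.Ici rmax) ∧
      (∀ r ∈ Set.Ici rp, r ≠ rmax → Vsig M l a r < Vsig M l a rmax) ∧
      rmax ≤ 3*M/(1 - a^2/l^2) := by
  set k := 1 - a^2/l^2 with hkdef
  have hk : 0 < k := by
    have : a^2 < l^2 := sq_lt_sq' (by linarith [neg_abs_le a]) (lt_of_le_of_lt (le_abs_self a) ha)
    have : a^2/l^2 < 1 := by rw [div_lt_one (by positivity)]; exact this
    linarith
  have hd : ∀ r, 0 < r → HasDerivAt (Vsig M l a) (2*r^2/(r^2+a^2)^3 * gaux M a k r) r :=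
    fun r hr => Vsig_hasDerivAt M l a r hl hr
  have hder : ∀ r, 0 < r → deriv (Vsig M l a) r = 2*r^2/(r^2+a^2)^3 * gaux M a k r :=
    fun r hr => (hd r hr).deriv
  have hfac : ∀ r, 0 < r → 0 < 2*r^2/(r^2+a^2)^3 := fun r hr => by positivity
  have hcont : ContinuousOn (Vsig M l a) (Set.Ici rp) := fun r hr =>
    (hd r (lt_of_lt_of_le hrp hr)).continuousAt.continuousWithinAt
  have hV0 : Vsig M l a rp = 0 := by simp [Vsig, hrp0]
  have hVpos : ∀ r, rp < r → 0 < Vsig M l a r := fun r hr => by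
    have := hrppos r hr
    have : 0 < r := hrp.trans hr
    unfold Vsig
    positivity
  have hcc := fun x y z => gaux_concave M a k x y z hM hk
  -- a point with positive derivative
  obtain ⟨r1, hr1, hg1⟩ : ∃ r1, rp < r1 ∧ 0 < gaux M a k r1 := by
    by_contra! hcon
    have : AntitoneOn (Vsig M l a) (Set.Ici rp) := by
      refine antitoneOn_of_deriv_nonpos (convex_Ici rp) hcont ?_ ?_
      · intro r hr
        rw [interior_Ici] at hr
        exact (hd r (hrp.trans hr)).differentiableAt.differentiableWithinAt
      · intro r hr
        rw [interior_Ici] at hr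
        rw [hder r (hrp.trans hr)]
        exact mul_nonpos_of_nonneg_of_nonpos (hfac r (hrp.trans hr)).le (hcon r hr)
    have h1 := this (Set.mem_Ici.2 le_rfl) (Set.mem_Ici.2 (by linarith : rp ≤ rp + 1))
      (by linarith)
    have h2 := hVpos (rp+1) (by linarith)
    linarith
  have hr1p : 0 < r1 := hrp.trans hr1
  have hgR : ∀ r, 3*M/k ≤ r → gaux M a k r ≤ 0 := by
    intro r hr
    have hr0 : 0 < r := lt_of_lt_of_le (by positivity) hr
    have h1 : 3*M ≤ r*k := (div_le_iff₀ hk).1 hr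
    have h2 : 0 ≤ k*a^2/r := by positivity
    have h3 : 0 ≤ M*a^2/r^2 := by positivity
    unfold gaux
    linarith
  have hr1R : r1 < 3*M/k := by
    by_contra! h
    linarith [hgR r1 h]
  have hgcont : ContinuousOn (gaux M a k) (Set.Icc r1 (3*M/k)) := by
    have hne : ∀ r ∈ Set.Icc r1 (3*M/k), r ≠ 0 := fun r hr => (lt_of_lt_of_le hr1p hr.1).ne'
    have hne2 : ∀ r ∈ Set.Icc r1 (3*M/k), r^2 ≠ 0 := fun r hr => pow_ne_zero 2 (hne r hr)
    unfold gaux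
    fun_prop (disch := assumption)
  obtain ⟨rm, hrm, hgm⟩ := intermediate_value_Icc' hr1R.le hgcont ⟨hgR _ le_rfl, hg1.le⟩
  have h1m : r1 < rm := lt_of_le_of_ne hrm.1 (by rintro rfl; linarith)
  have hpm : rp < rm := hr1.trans h1m
  have hm0 : 0 < rm := hrp.trans hpm
  have hneg : ∀ r, rm < r → gaux M a k r < 0 := by
    intro r hr
    have := hcc r1 rm r hr1p h1m hr
    rw [hgm] at this
    by_contra! h
    have := mul_pos (sub_pos.2 hr) hg1
    have := mul_nonneg (sub_pos.2 h1m).le h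
    linarith
  have hmid : ∀ r, r1 ≤ r → r < rm → 0 < gaux M a k r := by
    intro r hr hr'
    rcases hr.eq_or_lt with rfl | hr
    · exact hg1
    have := hcc r1 r rm hr1p hr hr'
    rw [hgm] at this
    have h2 := mul_pos (sub_pos.2 hr') hg1
    exact pos_of_mul_pos_right (a := rm - r1) (by linarith) (by linarith)
  have hpos : ∀ r, rp < r → r < rm → 0 < gaux M a k r := by
    intro r hr hr'
    rcases le_or_gt r1 r with h | h
    · exact hmid r h hr'
    by_contra! hc
    have hlow : ∀ x, rp < x → x < r → gaux M a k x < 0 := by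
      intro x hx hxr
      have := hcc x r r1 (hrp.trans hx) hxr h
      by_contra! h0
      have := mul_nonneg (sub_pos.2 h).le h0
      have := mul_pos (sub_pos.2 hxr) hg1
      have := mul_nonneg (sub_pos.2 (hxr.trans h)).le (neg_nonneg.2 hc)
      linarith
    have : StrictAntiOn (Vsig M l a) (Set.Icc rp r) := by
      refine strictAntiOn_of_deriv_neg (convex_Icc rp r) (hcont.mono Set.Icc_subset_Ici_self) ?_
      intro x hx
      rw [interior_Icc] at hx
      rw [hder x (hrp.trans hx.1)]
      exact mul_neg_of_pos_of_neg (hfac x (hrp.trans hx.1)) (hlow x hx.1 hx.2)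
    have := this (Set.left_mem_Icc.2 hr.le) (Set.right_mem_Icc.2 hr.le) hr
    linarith [hVpos r hr]
  have hdpos : ∀ r ∈ Set.Ioo rp rm, 0 < deriv (Vsig M l a) r := by
    intro r hr
    rw [hder r (hrp.trans hr.1)]
    exact mul_pos (hfac r (hrp.trans hr.1)) (hpos r hr.1 hr.2)
  have hdneg : ∀ r, rm < r → deriv (Vsig M l a) r < 0 := by
    intro r hr
    rw [hder r (hm0.trans hr)]
    exact mul_neg_of_pos_of_neg (hfac r (hm0.trans hr)) (hneg r hr)
  have hanti : StrictAntiOn (Vsig M l a) (Set.Ici rm) := by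
    refine strictAntiOn_of_deriv_neg (convex_Ici rm)
      (hcont.mono (Set.Ici_subset_Ici.2 hpm.le)) ?_
    intro x hx
    rw [interior_Ici] at hx
    exact hdneg x hx
  have hmono : StrictMonoOn (Vsig M l a) (Set.Icc rp rm) := by
    refine strictMonoOn_of_deriv_pos (convex_Icc rp rm)
      (hcont.mono Set.Icc_subset_Ici_self) ?_
    intro x hx
    rw [interior_Icc] at hx
    exact hdpos x hx
  have hlt : ∀ r ∈ Set.Ici rp, r ≠ rm → Vsig M l a r < Vsig M l a rm := by
    intro r hr hne
    rcases lt_or_gt_of_ne hne with h | h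
    · exact hmono ⟨hr, h.le⟩ (Set.right_mem_Icc.2 hpm.le) h
    · exact hanti (Set.mem_Ici.2 le_rfl) (Set.mem_Ici.2 h.le) h
  refine ⟨rm, hpm, ?_, ?_, hdpos, hdneg, hanti, hlt, hrm.2⟩
  · intro r hr
    rcases eq_or_ne r rm with rfl | h
    · exact le_refl (Vsig M l a r)
    · exact (hlt r hr h).le
  · intro r' hr' hmax
    by_contra hne
    have h1 := hlt r' hr'.le hne
    have h2 : Vsig M l a rm ≤ Vsig M l a r' := hmax (Set.mem_Ici.2 hpm.le)
    linarith
end
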